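/- arXiv:1404.6794 — 2 statements merged into one kernel-verified Lean document; each statement's English description precedes it below -/
import Mathlib

section
/- Fix a nonzero scalar q ∈ F that is not a root of unity, and scalars α, α*, a, a′, b, b′, c ∈ F with c ≠ 0. Define θ_i = α + a·q^{2i−d} + a′·q^{d−2i} and x_i = α* + (b+b′)q^{d−2i} + a′c·q^{d−2i}(q^{d+1} + q^{−d−1} − q^{d−2i−1} − q^{d−2i+1}) for 0 ≤ i ≤ d, and y_i = (q^i − q^{−i})(q^{d−i+1} − q^{i−d−1})(b − a′c·q^{d−2i+1})(b′ − a′c·q^{d−2i+1})c^{−1} and z_i = −c·q^{d−2i+1} for 1 ≤ i ≤ d. Let A ∈ Mat_{d+1}(F) be the lower bidiagonal matrix with diagonal entries θ_0,…,θ_d and all subdiagonal entries equal to 1, and let A* ∈ Mat_{d+1}(F) be the tridiagonal matrix with diagonal entries x_0,…,x_d, superdiagonal entries y_1,…,y_d and subdiagonal entries z_1,…,z_d. Then A* is irreducible tridiagonal and (A, A*) is a Leonard pair in Mat_{d+1}(F) if and only if the following three conditions hold: (C1) a ≠ a′q^{2d−2j} for 1 ≤ j ≤ 2d−1; (C2)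 b ≠ b′q^{2d−2j} for 1 ≤ j ≤ 2d−1; (C3) neither b·c^{−1} nor b′·c^{−1} belongs to {a·q^{d−2j+1} : 1 ≤ j ≤ d} ∪ {a′·q^{d−2j+1} : 1 ≤ j ≤ d}. -/
def IsTridiagonal {F : Type*} [Field F] {n : ℕ} (M : Matrix (Fin n) (Fin n) F) : Prop :=
  ∀ i j : Fin n,
    ¬((i : ℕ) = (j : ℕ) ∨ (i : ℕ) = (j : ℕ) + 1 ∨ (j : ℕ) = (i : ℕ) + 1) → M i j = 0

def IsIrredTridiagonal {F : Type*} [Field F] {n : ℕ} (M : Matrix (Fin n) (Fin n) F) : Prop :=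
  IsTridiagonal M ∧
    ∀ i j : Fin n, ((i : ℕ) = (j : ℕ) + 1 ∨ (j : ℕ) = (i : ℕ) + 1) → M i j ≠ 0

def IsLowerBidiagonal {F : Type*} [Field F] {n : ℕ} (M : Matrix (Fin n) (Fin n) F) : Prop :=
  ∀ i j : Fin n, ¬((i : ℕ) = (j : ℕ) ∨ (i : ℕ) = (j : ℕ) + 1) → M i j = 0

/-- A Leonard pair in `Mat_{n}(F)`: each matrix is irreducible tridiagonal in some basis
diagonalizing the other one. -/
def IsLeonardPair {F : Type*} [Field F] {n : ℕ} (A As : Matrix (Fin n) (Fin n) F) : Prop :=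
  (∃ P : Matrix (Fin n) (Fin n) F, IsUnit P ∧
    IsIrredTridiagonal (P⁻¹ * A * P) ∧ (P⁻¹ * As * P).IsDiag) ∧
  (∃ Q : Matrix (Fin n) (Fin n) F, IsUnit Q ∧
    IsIrredTridiagonal (Q⁻¹ * As * Q) ∧ (Q⁻¹ * A * Q).IsDiag)

set_option linter.unusedVariables false

section Operators

variable {F : Type*} [Field F]

/-- The `i`-th eigenvalue of the lower bidiagonal matrix, as a function of `r = q ^ i`. -/
def lbEig (p a a' r : F) : F := a * r ^ 2 / p + a' * p / r ^ 2

/-- The diagonal entry of the tridiagonal matrix, as a function of `r = q ^ i`. -/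
def tdDiag (q p a' b b' c r : F) : F :=
  (b + b') * (p / r ^ 2) +
    a' * c * (p / r ^ 2) * (p * q + 1 / (p * q) - p / (r ^ 2 * q) - p * q / r ^ 2)

/-- The superdiagonal entry of the tridiagonal matrix, as a function of `r = q ^ i`. -/
def tdSup (q p a' b b' c r : F) : F :=
  (r - 1 / r) * (p * q / r - r / (p * q)) * (b - a' * c * (p * q / r ^ 2)) *
    (b' - a' * c * (p * q / r ^ 2)) / c

/-- The subdiagonal entry of the tridiagonal matrix, as a function of `r = q ^ i`. -/
def tdSub (q p c r : F) : F := -(c * (p * q / r ^ 2))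

/-- The lower bidiagonal operator on bi-infinite sequences. -/
def lbOp (q p a a' : F) (f : ℤ → F) (i : ℤ) : F := lbEig p a a' (q ^ i) * f i + f (i - 1)

/-- The tridiagonal operator on bi-infinite sequences. -/
def tdOp (q p a' b b' c : F) (f : ℤ → F) (i : ℤ) : F :=
  tdSub q p c (q ^ i) * f (i - 1) + tdDiag q p a' b b' c (q ^ i) * f i +
    tdSup q p a' b b' c (q ^ (i + 1)) * f (i + 1)

def awOmega (q p a a' b b' c : F) : F :=
  -((q - 1 / q) ^ 2 *
    ((a + a') * (b + b') + (p * q + 1 / (p * q)) * (a * a' * c + b * b' / c)))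

def awEta (q p a a' b b' c : F) : F :=
  (q - 1 / q) ^ 2 * (q + 1 / q) *
    (a * a' * c * (a + a') + a * a' * (b + b') * (p * q + 1 / (p * q)) + (a + a') * (b * b' / c))

set_option maxHeartbeats 4000000 in
theorem aw_lbOp_tdOp {q p c : F} (a a' b b' : F) (hq : q ≠ 0) (hp : p ≠ 0) (hc : c ≠ 0)
    (f : ℤ → F) (i : ℤ) :
    lbOp q p a a' (lbOp q p a a' (tdOp q p a' b b' c f)) i
      - (q ^ 2 + 1 / q ^ 2) * lbOp q p a a' (tdOp q p a' b b' c (lbOp q p a a' f)) i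
      + tdOp q p a' b b' c (lbOp q p a a' (lbOp q p a a' f)) i
      + (q ^ 2 - 1 / q ^ 2) ^ 2 * (a * a') * tdOp q p a' b b' c f i
    = awOmega q p a a' b b' c * lbOp q p a a' f i + awEta q p a a' b b' c * f i := by
  have h1 : i - 1 + 1 = i := by ring
  have h2 : i + 1 - 1 = i := by ring
  have h3 : i - 1 - 1 + 1 = i - 1 := by ring
  simp only [lbOp, tdOp, h1, h2, h3]
  have e1 : q ^ (i - 1) = q ^ i / q := by rw [zpow_sub_one₀ hq, div_eq_mul_inv]
  have e2 : q ^ (i - 1 - 1) = q ^ i / q ^ 2 := by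
    rw [zpow_sub_one₀ hq, zpow_sub_one₀ hq]; field_simp
  have e3 : q ^ (i + 1) = q ^ i * q := by rw [zpow_add_one₀ hq]
  have hr : q ^ i ≠ 0 := zpow_ne_zero _ hq
  simp only [e1, e2, e3]
  generalize q ^ i = r at *
  generalize f i = f0
  generalize f (i-1) = f1
  generalize f (i-1-1) = f2
  generalize f (i-1-1-1) = f3
  generalize f (i+1) = f4
  simp only [lbEig, tdDiag, tdSup, tdSub, awOmega, awEta]
  field_simp
  ring
set_option maxHeartbeats 16000000 in
theorem aw_tdOp_lbOp {q p c : F} (a a' b b' : F) (hq : q ≠ 0) (hp : p ≠ 0) (hc : c ≠ 0)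
    (f : ℤ → F) (i : ℤ) :
    tdOp q p a' b b' c (tdOp q p a' b b' c (lbOp q p a a' f)) i
      - (q ^ 2 + 1 / q ^ 2) * tdOp q p a' b b' c (lbOp q p a a' (tdOp q p a' b b' c f)) i
      + lbOp q p a a' (tdOp q p a' b b' c (tdOp q p a' b b' c f)) i
      + (q ^ 2 - 1 / q ^ 2) ^ 2 * (b * b') * lbOp q p a a' f i
    = awOmega q p a a' b b' c * tdOp q p a' b b' c f i
      + awEta q p b b' a a' (1 / c) * f i := by
  have h1 : i - 1 + 1 = i := by ring
  have h2 : i + 1 - 1 = i := by ring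
  have h3 : i - 1 - 1 + 1 = i - 1 := by ring
  have h4 : i + 1 + 1 - 1 = i + 1 := by ring
  simp only [lbOp, tdOp, h1, h2, h3, h4]
  have e1 : q ^ (i - 1) = q ^ i / q := by rw [zpow_sub_one₀ hq, div_eq_mul_inv]
  have e2 : q ^ (i - 1 - 1) = q ^ i / q ^ 2 := by
    rw [zpow_sub_one₀ hq, zpow_sub_one₀ hq]; field_simp
  have e3 : q ^ (i + 1) = q ^ i * q := by rw [zpow_add_one₀ hq]
  have e4 : q ^ (i + 1 + 1) = q ^ i * q ^ 2 := by
    rw [zpow_add_one₀ hq, zpow_add_one₀ hq]; ring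
  have hr : q ^ i ≠ 0 := zpow_ne_zero _ hq
  simp only [e1, e2, e3, e4]
  generalize q ^ i = r at *
  generalize f i = f0
  generalize f (i-1) = f1
  generalize f (i-1-1) = f2
  generalize f (i-1-1-1) = f3
  generalize f (i+1) = f4
  generalize f (i+1+1) = f5
  simp only [lbEig, tdDiag, tdSup, tdSub, awOmega, awEta]
  field_simp
  ring

/-- Factor of a first coordinate of an eigenvector. -/
def eigRatio (q p a' b' c r : F) : F :=
  -((r - 1 / r) * (b' - a' * c * (p * q / r ^ 2)) * (r / q) / c)

theorem eigvec_identity {q p c r : F} (a' b b' : F) (hq : q ≠ 0) (hp : p ≠ 0) (hc : c ≠ 0)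
    (hr : r ≠ 0) :
    tdSub q p c r * eigRatio q p a' b' c r + tdDiag q p a' b b' c r
    - ((p / r - r / p) * (b - a' * c * (p * q / (r * q) ^ 2)) / r) = lbEig p b b' 1 := by
  simp only [lbEig, tdDiag, tdSub, eigRatio]
  field_simp
  ring

theorem tdSup_eq {q p c r : F} (a' b b' : F) (hq : q ≠ 0) (hp : p ≠ 0) (hc : c ≠ 0)
    (hr : r ≠ 0) :
    tdSup q p a' b b' c (r * q) = - ((p / r - r / p) * (b - a' * c * (p * q / (r * q) ^ 2)) / r) * eigRatio q p a' b' c (r * q) := by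
  simp only [tdSup, eigRatio]
  field_simp

theorem subdiag_identity {q p c r : F} (a a' b b' : F) (hq : q ≠ 0) (hp : p ≠ 0) (hc : c ≠ 0)
    (hr : r ≠ 0) (D₁ D₀ D₂ : F)
    (h1 : D₁ = a * r ^ 2 / p - a' * p / r ^ 2)
    (h0 : D₀ = a * q * r ^ 2 / p - a' * p / (q * r ^ 2))
    (h2 : D₂ = a * q ^ 2 * r ^ 2 / p - a' * p / (q ^ 2 * r ^ 2)) :
    tdSub q p c (r * q) * ((q - 1/q) ^ 2 * (q ^ 2 - 1/q^2) * D₁ * D₀ ^2 * D₂) -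
    (tdDiag q p a' b b' c (r * q) - tdDiag q p a' b b' c r) * ((q - 1/q) * (q ^ 2 - 1/q^2) * D₁ * D₀ * D₂)
    - tdSup q p a' b b' c (r * q) * ((q^2-1/q^2) * D₁ * D₂)
    + tdSup q p a' b b' c (r * q ^ 2) * ((q - 1/q)*D₁*D₀)
    + tdSup q p a' b b' c r * ((q - 1/q)*D₂*D₀)
     = -(1 / c) * ((a * r / p - a' * p / r) * (a * q * r - a' / (q * r)) *
      (b - a * c * (r ^ 2 * q / p)) * (b' - a * c * (r ^ 2 * q / p))) * ((q-1/q)^2 * (q^2-1/q^2)) := by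
  subst h1 h0 h2
  simp only [tdSub, tdDiag, tdSup]
  field_simp
  ring

theorem krylov_identity {q p c r : F} (a a' b b' : F) (hq : q ≠ 0) (hp : p ≠ 0) (hc : c ≠ 0)
    (hr : r ≠ 0) :
    tdSub q p c r * eigRatio q p a' b' c r *
        (lbEig p a a' (r / q) + eigRatio q p a' b' c (r / q))
      + tdDiag q p a' b b' c r * (lbEig p a a' r + eigRatio q p a' b' c r)
      - (p / r - r / p) * (b - a' * c * (p * q / (r * q) ^ 2)) / r *
        (lbEig p a a' (r * q) + eigRatio q p a' b' c (r * q))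
      - lbEig p b b' q * (lbEig p a a' r + eigRatio q p a' b' c r)
    = tdDiag q p a' b b' c 1 * lbEig p a a' 1
      - (p - 1 / p) * (b - a' * c * (p / q)) * (lbEig p a a' q + eigRatio q p a' b' c q)
      - lbEig p b b' q * lbEig p a a' 1 := by
  simp only [lbEig, tdDiag, tdSub, eigRatio]
  field_simp
  ring

end Operators

section LinearAlgebra

open Matrix Polynomial

variable {F : Type*} [Field F] {n : ℕ}

/-- The only subspaces invariant under both matrices are the trivial ones. -/
def IsJointlyIrreducible (A B : Matrix (Fin n) (Fin n) F) : Prop :=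
  ∀ W : Submodule F (Fin n → F), (∀ v ∈ W, A *ᵥ v ∈ W) → (∀ v ∈ W, B *ᵥ v ∈ W) →
    W = ⊥ ∨ W = ⊤

theorem IsJointlyIrreducible.of_conj {A B Q : Matrix (Fin n) (Fin n) F} (hQ : IsUnit Q)
    (h : IsJointlyIrreducible (Q⁻¹ * A * Q) (Q⁻¹ * B * Q)) : IsJointlyIrreducible A B := by
  have hdet := (Matrix.isUnit_iff_isUnit_det Q).1 hQ
  intro W hA hB
  have key : ∀ M : Matrix (Fin n) (Fin n) F, (∀ v ∈ W, M *ᵥ v ∈ W) →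
      ∀ v ∈ W.comap Q.mulVecLin, (Q⁻¹ * M * Q) *ᵥ v ∈ W.comap Q.mulVecLin := by
    intro M hM v hv
    simp only [Submodule.mem_comap, mulVecLin_apply] at hv ⊢
    rw [mulVec_mulVec, ← mul_assoc, ← mul_assoc, mul_nonsing_inv _ hdet, one_mul, ← mulVec_mulVec]
    exact hM _ hv
  have hback : ∀ v, Q *ᵥ (Q⁻¹ *ᵥ v) = v := fun v => by
    rw [mulVec_mulVec, mul_nonsing_inv _ hdet, one_mulVec]
  rcases h _ (key A hA) (key B hB) with h | h
  · left
    rw [eq_bot_iff]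
    intro v hv
    have : Q⁻¹ *ᵥ v ∈ W.comap Q.mulVecLin := by simpa [hback] using hv
    rw [h, Submodule.mem_bot] at this
    rw [Submodule.mem_bot, ← hback v, this, mulVec_zero]
  · right
    rw [eq_top_iff]
    intro v _
    have : Q⁻¹ *ᵥ v ∈ W.comap Q.mulVecLin := by rw [h]; trivial
    simpa [hback] using this

theorem IsJointlyIrreducible.conj {A B Q : Matrix (Fin n) (Fin n) F} (hQ : IsUnit Q)
    (h : IsJointlyIrreducible A B) : IsJointlyIrreducible (Q⁻¹ * A * Q) (Q⁻¹ * B * Q) := by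
  have hdet := (Matrix.isUnit_iff_isUnit_det Q).1 hQ
  refine IsJointlyIrreducible.of_conj (Q := Q⁻¹) (Matrix.isUnit_nonsing_inv_iff.2 hQ) ?_
  simpa [nonsing_inv_nonsing_inv _ hdet, mul_assoc, mul_nonsing_inv _ hdet,
    mul_nonsing_inv_cancel_left _ _ hdet] using h

theorem IsJointlyIrreducible.of_diagonal {D : Fin n → F} (hD : Function.Injective D)
    {T : Matrix (Fin n) (Fin n) F} (hT : IsIrredTridiagonal T) :
    IsJointlyIrreducible (diagonal D) T := by
  intro W hA hB
  by_cases hW : W = ⊥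
  · exact Or.inl hW
  right
  have comp : ∀ v ∈ W, ∀ i, v i ≠ 0 → Pi.single i 1 ∈ W := by
    intro v hv i hi
    have hs : ∀ s : Finset (Fin n), (fun k => (∏ j ∈ s, (D k - D j)) * v k) ∈ W := by
      intro s
      induction s using Finset.induction_on with
      | empty => simpa using hv
      | insert j s hj ih =>
        have := W.sub_mem (hA _ ih) (W.smul_mem (D j) ih)
        convert this using 1
        ext k
        simp [Finset.prod_insert hj, mulVec_diagonal]
        ring
    have h1 := W.smul_mem ((∏ j ∈ Finset.univ.erase i, (D i - D j)) * v i)⁻¹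
      (hs (Finset.univ.erase i))
    have h2 : (∏ j ∈ Finset.univ.erase i, (D i - D j)) ≠ 0 :=
      Finset.prod_ne_zero_iff.2 fun j hj =>
        sub_ne_zero.2 fun h => (Finset.ne_of_mem_erase hj) (hD h).symm
    convert h1 using 1
    ext k
    by_cases hk : k = i
    · subst hk
      simp only [Pi.single_eq_same, Pi.smul_apply, smul_eq_mul]
      exact (inv_mul_cancel₀ (mul_ne_zero h2 hi)).symm
    · have : (∏ j ∈ Finset.univ.erase i, (D k - D j)) = 0 :=
        Finset.prod_eq_zero (Finset.mem_erase.2 ⟨hk, Finset.mem_univ k⟩) (sub_self _)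
      simp [this, hk]
  have move : ∀ i j, T i j ≠ 0 → Pi.single j 1 ∈ W → Pi.single i 1 ∈ W := by
    intro i j hij hj
    refine comp _ (hB _ hj) i ?_
    simpa using hij
  obtain ⟨v, hv, hv0⟩ := W.ne_bot_iff.1 hW
  obtain ⟨i₀, hi₀⟩ := Function.ne_iff.1 hv0
  have hi₀ := comp v hv i₀ hi₀
  have hn : 0 < n := i₀.pos
  have step : ∀ k (hk : k < n),
      (Pi.single ⟨k, hk⟩ 1 ∈ W ↔ (Pi.single ⟨0, hn⟩ 1 : Fin n → F) ∈ W) := by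
    intro k
    induction k with
    | zero => intro hk; rfl
    | succ k ih =>
      intro hk
      rw [← ih (by omega)]
      exact ⟨move _ _ (hT.2 _ _ (Or.inr rfl)), move _ _ (hT.2 _ _ (Or.inl rfl))⟩
  have all : ∀ k, (Pi.single k 1 : Fin n → F) ∈ W := fun k =>
    (step k k.2).2 ((step i₀ i₀.2).1 hi₀)
  rw [eq_top_iff]
  intro w _
  rw [pi_eq_sum_univ' w]
  exact W.sum_mem fun k _ => W.smul_mem _ (by simpa [Pi.single_apply, Pi.single, Function.update] using all k)

theorem IsJointlyIrreducible.isIrredTridiagonal {D : Fin n → F}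
    {T : Matrix (Fin n) (Fin n) F} (h : IsJointlyIrreducible (diagonal D) T)
    (hT : IsTridiagonal T) : IsIrredTridiagonal T := by
  have key : ∀ (S : Fin n → Prop) (i j : Fin n), S j → ¬ S i →
      ∃ k l, S l ∧ ¬ S k ∧ T k l ≠ 0 := by
    intro S i j hj hi
    by_contra! hcon
    let W : Submodule F (Fin n → F) :=
      { carrier := {v | ∀ k, ¬ S k → v k = 0}
        add_mem' := fun {a b} ha hb k hk => by simp [ha k hk, hb k hk]
        zero_mem' := fun k _ => rfl
        smul_mem' := fun c {a} ha k hk => by simp [ha k hk] }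
    have hW : ∀ v, v ∈ W ↔ ∀ k, ¬ S k → v k = 0 := fun v => Iff.rfl
    rcases h W (fun v hv k hk => by simp [mulVec_diagonal, (hW v).1 hv k hk])
      (fun v hv k hk => by
        rw [mulVec_eq_sum, Finset.sum_apply]
        refine Finset.sum_eq_zero fun l _ => ?_
        by_cases hl : S l
        · simp [hcon k l hl hk]
        · simp [(hW v).1 hv l hl]) with h | h
    · have : (Pi.single j 1 : Fin n → F) ∈ W := (hW _).2 fun k hk =>
        Pi.single_eq_of_ne (fun hkj => hk (by rwa [hkj])) _
      rw [h, Submodule.mem_bot, Pi.single_eq_zero_iff] at this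
      exact one_ne_zero this
    · have : (Pi.single i 1 : Fin n → F) ∈ W := by rw [h]; trivial
      have := (hW _).1 this i hi
      simp at this
  refine ⟨hT, ?_⟩
  rintro i j (hij | hij)
  · obtain ⟨k, l, hl, hk, hkl⟩ := key (fun m => m ≤ j) i j le_rfl (by rw [Fin.le_def]; omega)
    have : ¬ ¬ _ := fun hh => hkl (hT k l hh)
    simp only [Fin.le_def] at hl hk
    have h1 : k = i := by ext; omega
    have h2 : l = j := by ext; omega
    rwa [← h1, ← h2]
  · obtain ⟨k, l, hl, hk, hkl⟩ := key (fun m => j ≤ m) i j le_rfl (by rw [Fin.le_def]; omega)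
    have : ¬ ¬ _ := fun hh => hkl (hT k l hh)
    simp only [Fin.le_def] at hl hk
    have h1 : k = i := by ext; omega
    have h2 : l = j := by ext; omega
    rwa [← h1, ← h2]

theorem isTridiagonal_of_aw {X Y Q : Matrix (Fin n) (Fin n) F} {D : Fin n → F} {β ρ ω η : F}
    (hQ : IsUnit Q) (hX : Q⁻¹ * X * Q = diagonal D)
    (haw : X * X * Y - β • (X * Y * X) + Y * X * X + ρ • Y = ω • X + η • 1)
    (hD : ∀ i j : Fin n,
      ¬((i : ℕ) = (j : ℕ) ∨ (i : ℕ) = (j : ℕ) + 1 ∨ (j : ℕ) = (i : ℕ) + 1) →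
      D i ^ 2 - β * D i * D j + D j ^ 2 + ρ ≠ 0) :
    IsTridiagonal (Q⁻¹ * Y * Q) := by
  have hdet := (Matrix.isUnit_iff_isUnit_det Q).1 hQ
  intro i j hij
  have hXQ : X * Q = Q * diagonal D := by
    rw [← hX, mul_assoc, mul_nonsing_inv_cancel_left _ _ hdet]
  have hYQ : Y * Q = Q * (Q⁻¹ * Y * Q) := by
    rw [mul_assoc, mul_nonsing_inv_cancel_left _ _ hdet]
  generalize Q⁻¹ * Y * Q = T at hYQ ⊢
  have h2 : Q * (diagonal D * diagonal D * T - β • (diagonal D * T * diagonal D)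
      + T * diagonal D * diagonal D + ρ • T) = Q * (ω • diagonal D + η • 1) := by
    have := congrArg (· * Q) haw
    simp only [add_mul, sub_mul, smul_mul_assoc, mul_assoc, one_mul, hXQ, hYQ] at this
    simp only [← mul_assoc, hXQ, hYQ] at this
    simp only [mul_add, mul_sub, mul_smul_comm, ← mul_assoc, mul_one]
    simpa only [mul_assoc, hXQ, hYQ] using this
  have h3 := congrArg (fun M => (Q⁻¹ * M) i j) h2
  simp only [nonsing_inv_mul_cancel_left _ _ hdet] at h3
  have hne : i ≠ j := fun h => hij (Or.inl (by rw [h]))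
  simp only [Matrix.add_apply, Matrix.sub_apply, Matrix.smul_apply, mul_diagonal, mul_assoc,
    diagonal_mul_diagonal, diagonal_mul, diagonal_apply_ne _ hne, one_apply_ne hne, smul_eq_mul, mul_zero,
    add_zero] at h3
  have h4 : (D i ^ 2 - β * D i * D j + D j ^ 2 + ρ) * T i j = 0 := by
    linear_combination h3
  exact (mul_eq_zero.1 h4).resolve_left (hD i j hij)

theorem diagonal_injective_of_conj {M P : Matrix (Fin n) (Fin n) F} {D : Fin n → F} (k₀ : Fin n)
    (hM : ∀ (t : F) (v : Fin n → F), M *ᵥ v = t • v → v k₀ = 0 → v = 0)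
    (hP : IsUnit P) (hD : P⁻¹ * M * P = diagonal D) : Function.Injective D := by
  have hdet := (Matrix.isUnit_iff_isUnit_det P).1 hP
  have hMP : M * P = P * diagonal D := by
    rw [← hD, mul_assoc, mul_nonsing_inv_cancel_left _ _ hdet]
  have hcol : ∀ i, M *ᵥ P.col i = D i • P.col i := fun i => by
    ext k
    have := congrFun (congrFun hMP k) i
    rw [mul_diagonal, mul_comm] at this
    exact this
  have hlin := linearIndependent_cols_iff_isUnit.2 hP
  intro i j hij
  by_contra hne
  have hpair : LinearIndependent F ![P.col i, P.col j] := by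
    have h : P.col ∘ ![i, j] = ![P.col i, P.col j] := by
      ext k
      fin_cases k <;> rfl
    rw [← h]
    exact hlin.comp _ (injective_pair_iff_ne.2 hne)
  have h0 : P k₀ j • P.col i - P k₀ i • P.col j = 0 := by
    refine hM (D i) _ ?_ ?_
    · rw [mulVec_sub, mulVec_smul, mulVec_smul, hcol, hcol, ← hij]
      module
    · simp [mul_comm]
  have h1 := LinearIndependent.pair_iff.1 hpair (P k₀ j) (-P k₀ i)
    (by rw [neg_smul, ← sub_eq_add_neg]; exact h0)
  exact hlin.ne_zero j (hM (D j) _ (hcol j) h1.1)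

theorem injective_of_charpoly_eq {M P : Matrix (Fin n) (Fin n) F} {D f : Fin n → F}
    (hP : IsUnit P) (hD : P⁻¹ * M * P = diagonal D) (hDinj : Function.Injective D)
    (hf : M.charpoly = ∏ i, (X - C (f i))) : Function.Injective f := by
  have hchar : M.charpoly = ∏ i, (X - C (D i)) := by
    rw [← charpoly_diagonal, ← hD]
    obtain ⟨U, rfl⟩ := hP
    rw [charpoly_units_conj']
  have hroots : ∀ g : Fin n → F, (∏ i, (X - C (g i))).roots = Finset.univ.val.map g := fun g => by
    rw [Finset.prod_eq_multiset_prod,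
      show (fun i => X - C (g i)) = (fun t => X - C t) ∘ g from rfl, ← Multiset.map_map,
      roots_multiset_prod_X_sub_C]
  have hmap : Finset.univ.val.map f = Finset.univ.val.map D := by
    rw [← hroots, ← hroots, ← hf, hchar]
  have hnodup : (Finset.univ.val.map f).Nodup := by
    rw [hmap]
    exact Finset.univ.nodup.map hDinj
  intro i j hij
  exact Multiset.inj_on_of_nodup_map hnodup i (Finset.mem_univ i) j (Finset.mem_univ j) hij

theorem exists_diagonalizing {M : Matrix (Fin n) (Fin n) F} {f : Fin n → F}
    (hinj : Function.Injective f) (hf : M.charpoly = ∏ i, (X - C (f i))) :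
    ∃ P : Matrix (Fin n) (Fin n) F, IsUnit P ∧ P⁻¹ * M * P = diagonal f := by
  have hev : ∀ i, ∃ v, Module.End.HasEigenvector M.mulVecLin (f i) v := fun i => by
    refine Module.End.HasEigenvalue.exists_hasEigenvector ?_
    rw [Module.End.hasEigenvalue_iff_isRoot_charpoly, charpoly_mulVecLin, hf, IsRoot.def,
      eval_prod]
    exact Finset.prod_eq_zero (Finset.mem_univ i) (by simp)
  choose w hw using hev
  have hlin := Module.End.eigenvectors_linearIndependent' M.mulVecLin f hinj w hw
  have hunit : IsUnit (of fun k i => w i k) :=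
    linearIndependent_cols_iff_isUnit.1 hlin
  refine ⟨_, hunit, ?_⟩
  have hdet := (Matrix.isUnit_iff_isUnit_det _).1 hunit
  have : M * (of fun k i => w i k) = (of fun k i => w i k) * diagonal f := by
    ext k i
    rw [mul_diagonal, of_apply, mul_comm]
    exact congrFun (hw i).apply_eq_smul k
  rw [mul_assoc, this, nonsing_inv_mul_cancel_left _ _ hdet]

theorem charpoly_eq_prod_of_aw {A B : Matrix (Fin n) (Fin n) F} {v : Fin n → F} {f : ℕ → F}
    {β ρ ω η κ : F} (hirr : IsJointlyIrreducible A B)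
    (haw : A * A * B - β • (A * B * A) + B * A * A + ρ • B = ω • A + η • 1)
    (hf : ∀ i, f (i + 2) = β * f (i + 1) - f i) (hv : v ≠ 0)
    (h0 : B *ᵥ v = f 0 • v) (h1 : B *ᵥ (A *ᵥ v) = f 1 • A *ᵥ v + κ • v) :
    B.charpoly = ∏ i : Fin n, (X - C (f i)) := by
  obtain ⟨i₀, -⟩ := Function.ne_iff.1 hv
  have hn : 0 < n := i₀.pos
  have haw' : ∀ w, A *ᵥ (A *ᵥ (B *ᵥ w)) - β • (A *ᵥ (B *ᵥ (A *ᵥ w))) + B *ᵥ (A *ᵥ (A *ᵥ w))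
      + ρ • (B *ᵥ w) = ω • (A *ᵥ w) + η • w := fun w => by
    have := congrArg (· *ᵥ w) haw
    simpa only [add_mulVec, sub_mulVec, smul_mulVec, ← mulVec_mulVec, one_mulVec] using this
  let u : ℕ → (Fin n → F) := fun i => (A ^ i) *ᵥ v
  have hu : ∀ i, A *ᵥ u i = u (i + 1) := fun i => by
    simp only [u, mulVec_mulVec, pow_succ']
  let W : ℕ → Submodule F (Fin n → F) := fun i => Submodule.span F (u '' Set.Iio i)
  have hmono : ∀ {i j}, i ≤ j → W i ≤ W j := fun h =>
    Submodule.span_mono (Set.image_mono (Set.Iio_subset_Iio h))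
  have hmem : ∀ {i j}, i < j → u i ∈ W j := fun h => Submodule.subset_span ⟨_, h, rfl⟩
  have hAW : ∀ i, ∀ w ∈ W i, A *ᵥ w ∈ W (i + 1) := fun i w hw => by
    have : W i ≤ (W (i + 1)).comap A.mulVecLin := by
      refine Submodule.span_le.2 ?_
      rintro _ ⟨k, hk, rfl⟩
      simp only [Submodule.comap_coe, Set.mem_preimage, mulVecLin_apply, SetLike.mem_coe, hu]
      exact hmem (Nat.succ_lt_succ hk)
    exact this hw
  have htri : ∀ i, B *ᵥ u i - f i • u i ∈ W i := by
    intro i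
    induction i using Nat.twoStepInduction with
    | zero => simp [u, h0]
    | one =>
      have : B *ᵥ u 1 - f 1 • u 1 = κ • u 0 := by simp [u, h1]
      rw [this]
      exact (W 1).smul_mem _ (hmem one_pos)
    | more i ih0 ih1 =>
      have h := haw' (u i)
      simp only [hu, add_assoc, Nat.reduceAdd] at h
      have e : B *ᵥ u (i + 2) - f (i + 2) • u (i + 2)
          = β • (A *ᵥ (B *ᵥ u (i + 1) - f (i + 1) • u (i + 1)))
            - A *ᵥ (A *ᵥ (B *ᵥ u i - f i • u i)) - ρ • (B *ᵥ u i - f i • u i)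
            - (ρ * f i) • u i + ω • u (i + 1) + η • u i := by
        simp only [mulVec_sub, mulVec_smul, hu, hf, add_assoc, Nat.reduceAdd]
        linear_combination (norm := module) h
      rw [e]
      refine add_mem (add_mem (sub_mem (sub_mem (sub_mem ?_ ?_) ?_) ?_) ?_) ?_
      · exact (W _).smul_mem _ (hAW _ _ ih1)
      · exact hAW _ _ (hAW _ _ ih0)
      · exact (W _).smul_mem _ (hmono (by omega) ih0)
      all_goals exact (W _).smul_mem _ (hmem (by omega))
  have hun : u n ∈ W n := by
    have hch := aeval_self_charpoly A
    rw [aeval_eq_sum_range, charpoly_natDegree_eq_dim, Fintype.card_fin, Finset.sum_range_succ]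
      at hch
    have hlead : A.charpoly.coeff n = 1 := by
      have := (charpoly_monic A).coeff_natDegree
      rwa [charpoly_natDegree_eq_dim, Fintype.card_fin] at this
    rw [hlead, one_smul] at hch
    have : u n = - ∑ i ∈ Finset.range n, A.charpoly.coeff i • u i := by
      simp only [u]
      rw [eq_neg_of_add_eq_zero_right hch, neg_mulVec, sum_mulVec]
      simp only [smul_mulVec]
    rw [this]
    exact neg_mem (sum_mem fun i hi => (W n).smul_mem _ (hmem (Finset.mem_range.1 hi)))
  have hWA : ∀ w ∈ W n, A *ᵥ w ∈ W n := fun w hw => by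
    refine (Submodule.span_le (p := W n)).2 ?_ (hAW n w hw)
    rintro _ ⟨k, hk, rfl⟩
    rcases Nat.lt_succ_iff_lt_or_eq.1 hk with hk | rfl
    · exact hmem hk
    · exact hun
  have hBu : ∀ i, B *ᵥ u i ∈ W (i + 1) := fun i => by
    rw [← sub_add_cancel (B *ᵥ u i) (f i • u i)]
    exact add_mem (hmono (Nat.le_succ i) (htri i)) ((W _).smul_mem _ (hmem (Nat.lt_succ_self i)))
  have hWB : ∀ w ∈ W n, B *ᵥ w ∈ W n := fun w hw => by
    have : W n ≤ (W n).comap B.mulVecLin := by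
      refine Submodule.span_le.2 ?_
      rintro _ ⟨k, hk, rfl⟩
      exact hmono hk (hBu k)
    exact this hw
  have htop : W n = ⊤ := by
    refine (hirr (W n) hWA hWB).resolve_left fun hbot => hv ?_
    have : u 0 ∈ W n := hmem hn
    rw [hbot, Submodule.mem_bot] at this
    simpa [u] using this
  have himg : ∀ i ≤ n, u '' Set.Iio i = (fun k : Fin n => u k) '' {k | (k : ℕ) < i} := by
    intro i hi
    ext w
    constructor
    · rintro ⟨k, hk, rfl⟩
      exact ⟨⟨k, lt_of_lt_of_le hk hi⟩, hk, rfl⟩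
    · rintro ⟨k, hk, rfl⟩
      exact ⟨k, hk, rfl⟩
  have hspan : ⊤ ≤ Submodule.span F (Set.range fun k : Fin n => u k) := by
    rw [← htop]
    refine Submodule.span_mono ?_
    rintro _ ⟨k, hk, rfl⟩
    exact ⟨⟨k, hk⟩, rfl⟩
  have hli := linearIndependent_of_top_le_span_of_card_eq_finrank hspan (by simp)
  let b := Module.Basis.mk hli hspan
  have hb : ∀ k, b k = u k := fun k => Module.Basis.mk_apply hli hspan k
  have hbW : ∀ i ≤ n, ∀ w ∈ W i, ∀ k : Fin n, i ≤ k → b.repr w k = 0 := by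
    intro i hi w hw k hk
    have hw' : w ∈ Submodule.span F (b '' {k | (k : ℕ) < i}) := by
      have : (b : Fin n → Fin n → F) = fun k : Fin n => u k := funext hb
      rw [this, ← himg i hi]
      exact hw
    rw [Module.Basis.mem_span_image] at hw'
    by_contra hne
    have := hw' (Finsupp.mem_support_iff.2 hne)
    simp only [Set.mem_ofPred_eq] at this
    omega
  rw [← charpoly_mulVecLin B, ← LinearMap.charpoly_toMatrix B.mulVecLin b,
    charpoly_of_isUpperTriangular]
  · refine Finset.prod_congr rfl fun i _ => ?_
    rw [LinearMap.toMatrix_apply, mulVecLin_apply, hb, ← sub_add_cancel (B *ᵥ u i) (f i • u i),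
      map_add, Finsupp.add_apply, hbW i i.2.le _ (htri i) i le_rfl, zero_add, map_smul, ← hb]
    simp
  · intro i j hij
    rw [LinearMap.toMatrix_apply, mulVecLin_apply, hb]
    exact hbW (j + 1) j.2 _ (hBu j) i hij

end LinearAlgebra

section Bands

open Matrix

variable {F : Type*} [Field F]

/-- The tridiagonal matrix with diagonal `x`, superdiagonal `y` and subdiagonal `z`. -/
def bandMatrix (d : ℕ) (x y z : ℤ → F) : Matrix (Fin (d + 1)) (Fin (d + 1)) F :=
  of fun i j =>
    if (i : ℕ) = (j : ℕ) then x (i : ℕ)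
    else if (i : ℕ) = (j : ℕ) + 1 then z (i : ℕ)
    else if (j : ℕ) = (i : ℕ) + 1 then y (j : ℕ) else 0

/-- The restriction of a bi-infinite sequence to the indices `0, …, d`. -/
def finRestrict (d : ℕ) (g : ℤ → F) : Fin (d + 1) → F := fun k => g (k : ℕ)

/-- The extension of a vector by zero to a bi-infinite sequence. -/
def zeroExtend {d : ℕ} (v : Fin (d + 1) → F) (k : ℤ) : F :=
  if h : 0 ≤ k ∧ k ≤ d then v ⟨k.toNat, by omega⟩ else 0

theorem zeroExtend_natCast {d : ℕ} (v : Fin (d + 1) → F) (k : Fin (d + 1)) :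
    zeroExtend v (k : ℕ) = v k := by
  have : (0 : ℤ) ≤ (k : ℕ) ∧ ((k : ℕ) : ℤ) ≤ d := by omega
  simp [zeroExtend, this]

theorem finRestrict_zeroExtend {d : ℕ} (v : Fin (d + 1) → F) :
    finRestrict d (zeroExtend v) = v := funext fun k => zeroExtend_natCast v k

theorem zeroExtend_of_neg {d : ℕ} (v : Fin (d + 1) → F) {k : ℤ} (hk : k < 0) :
    zeroExtend v k = 0 := by
  rw [zeroExtend, dif_neg (by omega)]

theorem zeroExtend_of_lt {d : ℕ} (v : Fin (d + 1) → F) {k : ℤ} (hk : (d : ℤ) < k) :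
    zeroExtend v k = 0 := by
  rw [zeroExtend, dif_neg (by omega)]

theorem sum_fin_eq_three {d : ℕ} {j : ℕ} (hj : j ≤ d) (f : ℤ → F)
    (hf : ∀ k : ℤ, k ≠ j - 1 → k ≠ j → k ≠ j + 1 → f k = 0) (h0 : f (-1) = 0)
    (h1 : f (d + 1) = 0) :
    ∑ k : Fin (d + 1), f (k : ℕ) = f (j - 1) + f j + f (j + 1) := by
  have hsum : ∑ k : Fin (d + 1), f (k : ℕ) = ∑ k ∈ Finset.Icc (-1 : ℤ) (d + 1), f k := by
    rw [Fin.sum_univ_eq_sum_range (fun k : ℕ => f (k : ℤ)) (d + 1)]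
    have himg : (Finset.range (d + 1)).image (fun k : ℕ => (k : ℤ)) ⊆ Finset.Icc (-1 : ℤ) (d + 1) := by
      intro k hk
      simp only [Finset.mem_image, Finset.mem_range, Finset.mem_Icc] at hk ⊢
      omega
    rw [← Finset.sum_image (f := f) (g := fun k : ℕ => (k : ℤ)) (by intro a _ b _ h; simpa using h)]
    refine Finset.sum_subset himg fun k hk hk' => ?_
    simp only [Finset.mem_image, Finset.mem_range, Finset.mem_Icc] at hk hk'
    by_cases hk1 : k = -1
    · rw [hk1, h0]
    by_cases hk2 : k = d + 1
    · rw [hk2, h1]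
    exact absurd ⟨k.toNat, by omega, by omega⟩ hk'
  have hthree : ({(j : ℤ) - 1, (j : ℤ), (j : ℤ) + 1} : Finset ℤ) ⊆ Finset.Icc (-1 : ℤ) (d + 1) := by
    intro k hk
    simp only [Finset.mem_insert, Finset.mem_singleton, Finset.mem_Icc] at hk ⊢
    omega
  rw [hsum, ← Finset.sum_subset hthree, Finset.sum_insert, Finset.sum_insert, Finset.sum_singleton,
    add_assoc]
  · simp
  · simp only [Finset.mem_insert, Finset.mem_singleton]
    omega
  · intro k _ hk
    simp only [Finset.mem_insert, Finset.mem_singleton, not_or] at hk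
    exact hf k hk.1 hk.2.1 hk.2.2

theorem bandMatrix_mulVec {d : ℕ} (x y z g : ℤ → F) (hg : g (-1) = 0) (hy : y (d + 1) = 0)
    (i : Fin (d + 1)) :
    (bandMatrix d x y z *ᵥ finRestrict d g) i =
      z (i : ℕ) * g ((i : ℕ) - 1) + x (i : ℕ) * g (i : ℕ) + y ((i : ℕ) + 1) * g ((i : ℕ) + 1) := by
  let f : ℤ → F := fun j =>
    (if ((i : ℕ) : ℤ) = j then x (i : ℕ)
    else if ((i : ℕ) : ℤ) = j + 1 then z (i : ℕ)
    else if j = (i : ℕ) + 1 then y j else 0) * g j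
  have hi : (i : ℕ) ≤ d := by omega
  have h := sum_fin_eq_three hi f ?_ ?_ ?_
  · rw [mulVec, dotProduct]
    convert h using 1
    · refine Finset.sum_congr rfl fun j _ => ?_
      simp only [bandMatrix, finRestrict, of_apply, f]
      norm_cast
    · simp only [f, sub_add_cancel, if_true]
      rw [if_neg (by omega), if_neg (by omega), if_neg (by omega)]
  · intro k h1 h2 h3
    simp only [f]
    rw [if_neg (by omega), if_neg (by omega), if_neg (by omega), zero_mul]
  · simp [f, hg]
  · simp only [f]
    rw [if_neg (by omega), if_neg (by omega)]
    simp [hy]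

end Bands

section Matrices

open Matrix

variable {F : Type*} [Field F]

/-- The lower bidiagonal matrix of the pair, with `α = 0`. -/
def lbMatrix (d : ℕ) (q a a' : F) : Matrix (Fin (d + 1)) (Fin (d + 1)) F :=
  bandMatrix d (fun i => lbEig (q ^ d) a a' (q ^ i)) 0 1

/-- The tridiagonal matrix of the pair, with `α* = 0`. -/
def tdMatrix (d : ℕ) (q a' b b' c : F) : Matrix (Fin (d + 1)) (Fin (d + 1)) F :=
  bandMatrix d (fun i => tdDiag q (q ^ d) a' b b' c (q ^ i))
    (fun i => tdSup q (q ^ d) a' b b' c (q ^ i)) (fun i => tdSub q (q ^ d) c (q ^ i))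

theorem tdSup_one (q p a' b b' c : F) : tdSup q p a' b b' c 1 = 0 := by simp [tdSup]

theorem tdSup_mul {q p : F} (hq : q ≠ 0) (hp : p ≠ 0) (a' b b' c : F) :
    tdSup q p a' b b' c (p * q) = 0 := by
  simp [tdSup, hq, hp]

theorem lbOp_of_neg {g : ℤ → F} (hg : ∀ k < 0, g k = 0) (q p a a' : F) :
    ∀ k < 0, lbOp q p a a' g k = 0 := by
  intro k hk
  simp [lbOp, hg k hk, hg (k - 1) (by omega)]

theorem tdOp_of_neg {g : ℤ → F} (hg : ∀ k < 0, g k = 0) (q p a' b b' c : F) :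
    ∀ k < 0, tdOp q p a' b b' c g k = 0 := by
  intro k hk
  rcases eq_or_ne k (-1) with rfl | h
  · simp [tdOp, hg, tdSup_one]
  · simp [tdOp, hg k hk, hg (k - 1) (by omega), hg (k + 1) (by omega)]

theorem lbMatrix_mulVec (d : ℕ) (q a a' : F) {g : ℤ → F} (hg : ∀ k < 0, g k = 0) :
    lbMatrix d q a a' *ᵥ finRestrict d g = finRestrict d (lbOp q (q ^ d) a a' g) := by
  ext i
  rw [lbMatrix, bandMatrix_mulVec _ _ _ _ (hg _ (by norm_num)) rfl]
  simp [finRestrict, lbOp, add_comm]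

theorem tdMatrix_mulVec (d : ℕ) {q : F} (hq : q ≠ 0) (a' b b' c : F) {g : ℤ → F}
    (hg : ∀ k < 0, g k = 0) :
    tdMatrix d q a' b b' c *ᵥ finRestrict d g =
      finRestrict d (tdOp q (q ^ d) a' b b' c g) := by
  ext i
  rw [tdMatrix, bandMatrix_mulVec _ _ _ _ (hg _ (by norm_num))]
  · rfl
  · rw [zpow_add_one₀ hq, zpow_natCast, tdSup_mul hq (pow_ne_zero _ hq)]

theorem aw_lbMatrix_tdMatrix (d : ℕ) {q c : F} (hq : q ≠ 0) (hc : c ≠ 0) (a a' b b' : F) :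
    lbMatrix d q a a' * lbMatrix d q a a' * tdMatrix d q a' b b' c
      - (q ^ 2 + 1 / q ^ 2) • (lbMatrix d q a a' * tdMatrix d q a' b b' c * lbMatrix d q a a')
      + tdMatrix d q a' b b' c * lbMatrix d q a a' * lbMatrix d q a a'
      + ((q ^ 2 - 1 / q ^ 2) ^ 2 * (a * a')) • tdMatrix d q a' b b' c
    = awOmega q (q ^ d) a a' b b' c • lbMatrix d q a a'
      + awEta q (q ^ d) a a' b b' c • 1 := by
  refine toLin'.injective (LinearMap.ext fun v => ?_)
  have h0 : ∀ k < 0, zeroExtend v k = 0 := fun k hk => zeroExtend_of_neg v hk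
  have hA := lbOp_of_neg h0 q (q ^ d) a a'
  have hAA := lbOp_of_neg hA q (q ^ d) a a'
  have hB := tdOp_of_neg h0 q (q ^ d) a' b b' c
  have hAB := lbOp_of_neg hB q (q ^ d) a a'
  have hBA := tdOp_of_neg hA q (q ^ d) a' b b' c
  simp only [toLin'_apply, add_mulVec, sub_mulVec, smul_mulVec, ← mulVec_mulVec, one_mulVec]
  rw [← finRestrict_zeroExtend v]
  rw [tdMatrix_mulVec d hq _ _ _ _ h0, lbMatrix_mulVec d _ _ _ h0, lbMatrix_mulVec d _ _ _ hB,
    lbMatrix_mulVec d _ _ _ hAB, tdMatrix_mulVec d hq _ _ _ _ hA, lbMatrix_mulVec d _ _ _ hBA,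
    lbMatrix_mulVec d _ _ _ hA, tdMatrix_mulVec d hq _ _ _ _ hAA]
  ext i
  exact aw_lbOp_tdOp a a' b b' hq (pow_ne_zero _ hq) hc (zeroExtend v) (i : ℕ)

theorem aw_tdMatrix_lbMatrix (d : ℕ) {q c : F} (hq : q ≠ 0) (hc : c ≠ 0) (a a' b b' : F) :
    tdMatrix d q a' b b' c * tdMatrix d q a' b b' c * lbMatrix d q a a'
      - (q ^ 2 + 1 / q ^ 2) •
        (tdMatrix d q a' b b' c * lbMatrix d q a a' * tdMatrix d q a' b b' c)
      + lbMatrix d q a a' * tdMatrix d q a' b b' c * tdMatrix d q a' b b' c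
      + ((q ^ 2 - 1 / q ^ 2) ^ 2 * (b * b')) • lbMatrix d q a a'
    = awOmega q (q ^ d) a a' b b' c • tdMatrix d q a' b b' c
      + awEta q (q ^ d) b b' a a' (1 / c) • 1 := by
  refine toLin'.injective (LinearMap.ext fun v => ?_)
  have h0 : ∀ k < 0, zeroExtend v k = 0 := fun k hk => zeroExtend_of_neg v hk
  have hA := lbOp_of_neg h0 q (q ^ d) a a'
  have hB := tdOp_of_neg h0 q (q ^ d) a' b b' c
  have hBB := tdOp_of_neg hB q (q ^ d) a' b b' c
  have hAB := lbOp_of_neg hB q (q ^ d) a a'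
  have hBA := tdOp_of_neg hA q (q ^ d) a' b b' c
  simp only [toLin'_apply, add_mulVec, sub_mulVec, smul_mulVec, ← mulVec_mulVec, one_mulVec]
  rw [← finRestrict_zeroExtend v]
  rw [tdMatrix_mulVec d hq _ _ _ _ h0, lbMatrix_mulVec d _ _ _ h0, tdMatrix_mulVec d hq _ _ _ _ hB,
    lbMatrix_mulVec d _ _ _ hB, lbMatrix_mulVec d _ _ _ hBB, tdMatrix_mulVec d hq _ _ _ _ hA,
    tdMatrix_mulVec d hq _ _ _ _ hBA, tdMatrix_mulVec d hq _ _ _ _ hAB]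
  ext i
  exact aw_tdOp_lbOp a a' b b' hq (pow_ne_zero _ hq) hc (zeroExtend v) (i : ℕ)

end Matrices

section Eigenvalues

variable {F : Type*} [Field F]

theorem subdiag_identity_left {q p c : F} (a a' b b' : F) (hq : q ≠ 0) (hp : p ≠ 0) (hc : c ≠ 0)
    (D₀ D₂ : F)
    (h0 : D₀ = a * q / p - a' * p / q)
    (h2 : D₂ = a * q ^ 2 / p - a' * p / q ^ 2) :
    tdSub q p c q * ((q - 1 / q) ^ 2 * (q ^ 2 - 1 / q ^ 2) * D₀ ^ 2 * D₂) -
    (tdDiag q p a' b b' c q - tdDiag q p a' b b' c 1) *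
      ((q - 1 / q) * (q ^ 2 - 1 / q ^ 2) * D₀ * D₂)
    - tdSup q p a' b b' c q * ((q ^ 2 - 1 / q ^ 2) * D₂)
    + tdSup q p a' b b' c (q ^ 2) * ((q - 1 / q) * D₀)
     = -(1 / c) * ((a * q - a' / q) *
      (b - a * c * (q / p)) * (b' - a * c * (q / p))) *
      ((q - 1 / q) ^ 2 * (q ^ 2 - 1 / q ^ 2)) := by
  subst h0 h2
  simp only [tdSub, tdDiag, tdSup]
  field_simp
  ring

theorem subdiag_identity_right {q c r : F} (a a' b b' : F) (hq : q ≠ 0) (hc : c ≠ 0)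
    (hr : r ≠ 0) (D₁ D₀ : F)
    (h1 : D₁ = a * r / q - a' * q / r)
    (h0 : D₀ = a * r - a' / r) :
    tdSub q (r * q) c (r * q) * ((q - 1 / q) ^ 2 * (q ^ 2 - 1 / q ^ 2) * D₁ * D₀ ^ 2) -
    (tdDiag q (r * q) a' b b' c (r * q) - tdDiag q (r * q) a' b b' c r) *
      ((q - 1 / q) * (q ^ 2 - 1 / q ^ 2) * D₁ * D₀)
    - tdSup q (r * q) a' b b' c (r * q) * ((q ^ 2 - 1 / q ^ 2) * D₁)
    + tdSup q (r * q) a' b b' c r * ((q - 1 / q) * D₀)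
     = -(1 / c) * ((a / q - a' * q) *
      (b - a * c * r) * (b' - a * c * r)) * ((q - 1 / q) ^ 2 * (q ^ 2 - 1 / q ^ 2)) := by
  subst h1 h0
  simp only [tdSub, tdDiag, tdSup]
  field_simp
  ring

theorem zpow_ne_one {q : F} (hqru : ∀ n : ℕ, 1 ≤ n → q ^ n ≠ 1) {m : ℤ} (hm : m ≠ 0) :
    q ^ m ≠ 1 := by
  rcases Int.natAbs_eq m with h | h <;> rw [h]
  · rw [zpow_natCast]
    exact hqru _ (by omega)
  · rw [zpow_neg, zpow_natCast, Ne, inv_eq_one]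
    exact hqru _ (by omega)

/-- The inequalities expressing that the eigenvalues `lbEig (q ^ d) a a' (q ^ i)` are distinct. -/
def IsSeparated (d : ℕ) (q a a' : F) : Prop :=
  ∀ n : ℤ, 1 ≤ n → n ≤ 2 * d - 1 → a ≠ a' * q ^ (2 * (d : ℤ) - 2 * n)

/-- The normalized difference of two eigenvalues whose indices have sum `n`. -/
def eigGap (d : ℕ) (q a a' : F) (n : ℤ) : F := a * q ^ n / q ^ d - a' * q ^ d / q ^ n

theorem eigGap_eq_zero_iff {d : ℕ} {q a a' : F} (hq : q ≠ 0) (n : ℤ) :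
    eigGap d q a a' n = 0 ↔ a = a' * q ^ (2 * (d : ℤ) - 2 * n) := by
  have hn : q ^ n ≠ 0 := zpow_ne_zero _ hq
  have hd : q ^ d ≠ 0 := pow_ne_zero _ hq
  have : q ^ (2 * (d : ℤ) - 2 * n) = (q ^ d) ^ 2 / (q ^ n) ^ 2 := by
    rw [zpow_sub₀ hq, mul_comm 2 (d : ℤ), mul_comm 2 n, zpow_mul, zpow_mul, zpow_natCast]
    norm_cast
  rw [this, eigGap, sub_eq_zero, div_eq_div_iff hd hn, ← mul_div_assoc,
    eq_div_iff (pow_ne_zero 2 hn)]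
  constructor <;> intro h <;> linear_combination h

theorem IsSeparated.eigGap_ne_zero {d : ℕ} {q a a' : F} (h : IsSeparated d q a a') (hq : q ≠ 0)
    {n : ℤ} (h1 : 1 ≤ n) (h2 : n ≤ 2 * d - 1) : eigGap d q a a' n ≠ 0 :=
  fun h0 => h n h1 h2 ((eigGap_eq_zero_iff hq n).1 h0)

theorem lbEig_sub_lbEig {d : ℕ} {q : F} (hq : q ≠ 0) (a a' : F) (i k : ℤ) :
    lbEig (q ^ d) a a' (q ^ i) - lbEig (q ^ d) a a' (q ^ k) =
      (q ^ (i - k) - 1 / q ^ (i - k)) * eigGap d q a a' (i + k) := by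
  have hi : q ^ i ≠ 0 := zpow_ne_zero _ hq
  have hk : q ^ k ≠ 0 := zpow_ne_zero _ hq
  have hd : q ^ d ≠ 0 := pow_ne_zero _ hq
  simp only [lbEig, eigGap, zpow_sub₀ hq, zpow_add₀ hq]
  field_simp
  ring

theorem zpow_sub_inv_ne_zero {q : F} (hq : q ≠ 0) (hqru : ∀ n : ℕ, 1 ≤ n → q ^ n ≠ 1) {m : ℤ}
    (hm : m ≠ 0) : q ^ m - 1 / q ^ m ≠ 0 := by
  have hqm : q ^ m ≠ 0 := zpow_ne_zero _ hq
  intro h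
  rw [sub_eq_zero, eq_div_iff hqm, ← zpow_add₀ hq] at h
  exact zpow_ne_one hqru (by omega) h

theorem IsSeparated.lbEig_ne {d : ℕ} {q a a' : F} (h : IsSeparated d q a a') (hq : q ≠ 0)
    (hqru : ∀ n : ℕ, 1 ≤ n → q ^ n ≠ 1) {i k : ℤ} (hik : i ≠ k) (h1 : 1 ≤ i + k)
    (h2 : i + k ≤ 2 * d - 1) : lbEig (q ^ d) a a' (q ^ i) ≠ lbEig (q ^ d) a a' (q ^ k) := by
  rw [← sub_ne_zero, lbEig_sub_lbEig hq]
  exact mul_ne_zero (zpow_sub_inv_ne_zero hq hqru (by omega)) (h.eigGap_ne_zero hq h1 h2)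

theorem IsSeparated.injective {d : ℕ} {q a a' : F} (h : IsSeparated d q a a') (hq : q ≠ 0)
    (hqru : ∀ n : ℕ, 1 ≤ n → q ^ n ≠ 1) :
    Function.Injective fun i : Fin (d + 1) => lbEig (q ^ d) a a' (q ^ (i : ℕ)) := by
  intro i k hik
  by_contra hne
  have : (i : ℕ) ≠ k := fun h => hne (Fin.ext h)
  refine h.lbEig_ne hq hqru (i := (i : ℕ)) (k := (k : ℕ)) (by omega) (by omega) (by omega) ?_
  simpa only [zpow_natCast] using hik

theorem isSeparated_of_injective {d : ℕ} {q a a' : F} (hq : q ≠ 0)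
    (h : Function.Injective fun i : Fin (d + 1) => lbEig (q ^ d) a a' (q ^ (i : ℕ))) :
    IsSeparated d q a a' := by
  intro n h1 h2 ha
  have key : ∀ i k : Fin (d + 1), ((i : ℕ) + (k : ℕ) : ℤ) = n → i = k := by
    intro i k hik
    refine h (sub_eq_zero.1 ?_)
    have := lbEig_sub_lbEig (d := d) hq a a' (i : ℕ) (k : ℕ)
    rw [hik, (eigGap_eq_zero_iff hq n).2 ha, mul_zero] at this
    simpa only [zpow_natCast] using this
  obtain ⟨m, rfl⟩ := Int.eq_ofNat_of_zero_le (by omega : 0 ≤ n)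
  by_cases hm : m ≤ d
  · have := key ⟨0, by omega⟩ ⟨m, by omega⟩ (by simp)
    rw [Fin.mk.injEq] at this
    omega
  · have := key ⟨m - d, by omega⟩ ⟨d, by omega⟩ (by simp only; omega)
    rw [Fin.mk.injEq] at this
    omega

theorem lbEig_aw_factor {q p r : F} (hq : q ≠ 0) (hp : p ≠ 0) (hr : r ≠ 0) (a a' t : F) :
    lbEig p a a' r ^ 2 - (q ^ 2 + 1 / q ^ 2) * lbEig p a a' r * t + t ^ 2 +
      (q ^ 2 - 1 / q ^ 2) ^ 2 * (a * a') =
    (t - lbEig p a a' (r * q)) * (t - lbEig p a a' (r / q)) := by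
  simp only [lbEig]
  field_simp
  ring

theorem IsSeparated.aw_factor_ne_zero {d : ℕ} {q a a' : F} (h : IsSeparated d q a a')
    (hq : q ≠ 0) (hqru : ∀ n : ℕ, 1 ≤ n → q ^ n ≠ 1) (i j : Fin (d + 1))
    (hij : ¬((i : ℕ) = (j : ℕ) ∨ (i : ℕ) = (j : ℕ) + 1 ∨ (j : ℕ) = (i : ℕ) + 1)) :
    lbEig (q ^ d) a a' (q ^ (i : ℕ)) ^ 2 -
        (q ^ 2 + 1 / q ^ 2) * lbEig (q ^ d) a a' (q ^ (i : ℕ)) * lbEig (q ^ d) a a' (q ^ (j : ℕ)) +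
        lbEig (q ^ d) a a' (q ^ (j : ℕ)) ^ 2 + (q ^ 2 - 1 / q ^ 2) ^ 2 * (a * a') ≠ 0 := by
  rw [lbEig_aw_factor hq (pow_ne_zero _ hq) (pow_ne_zero _ hq)]
  have e1 : q ^ (i : ℕ) * q = q ^ ((i : ℤ) + 1) := by rw [zpow_add_one₀ hq, zpow_natCast]
  have e2 : q ^ (i : ℕ) / q = q ^ ((i : ℤ) - 1) := by
    rw [zpow_sub_one₀ hq, zpow_natCast, div_eq_mul_inv]
  rw [e1, e2, ← zpow_natCast q (j : ℕ)]
  exact mul_ne_zero (sub_ne_zero.2 (h.lbEig_ne hq hqru (by omega) (by omega) (by omega)))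
    (sub_ne_zero.2 (h.lbEig_ne hq hqru (by omega) (by omega) (by omega)))

end Eigenvalues

section Eigenvector

open Matrix Polynomial

variable {F : Type*} [Field F]

/-- An eigenvector of the tridiagonal matrix, as a bi-infinite sequence. -/
noncomputable def eigVec (d : ℕ) (q a' b' c : F) (k : ℤ) : F :=
  if k < 0 then 0 else ∏ l ∈ Finset.Ioc k d, eigRatio q (q ^ d) a' b' c (q ^ l)

theorem eigVec_of_neg (d : ℕ) (q a' b' c : F) : ∀ k < 0, eigVec d q a' b' c k = 0 :=
  fun _ hk => if_pos hk

theorem eigVec_sub_one (d : ℕ) (q a' b' c : F) {k : ℤ} (h0 : 0 ≤ k) (hk : k ≤ d) :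
    eigVec d q a' b' c (k - 1) =
      eigRatio q (q ^ d) a' b' c (q ^ k) * eigVec d q a' b' c k := by
  rcases eq_or_lt_of_le h0 with rfl | hpos
  · simp [eigVec, eigRatio]
  · have hins : Finset.Ioc (k - 1) (d : ℤ) = insert k (Finset.Ioc k d) := by
      ext l
      simp only [Finset.mem_Ioc, Finset.mem_insert]
      omega
    rw [eigVec, eigVec, if_neg (by omega), if_neg (by omega), hins, Finset.prod_insert (by simp)]

theorem eigVec_ne_zero (d : ℕ) (q a' b' c : F) : finRestrict d (eigVec d q a' b' c) ≠ 0 := by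
  intro h
  have := congrFun h (Fin.last d)
  simp [finRestrict, eigVec] at this

theorem tdOp_mul_eigVec {d : ℕ} {q c : F} (hq : q ≠ 0) (hc : c ≠ 0) (a' b b' : F) (g h : ℤ → F)
    (hneg : g (-1) = 0)
    (hg : ∀ k : ℤ, 0 ≤ k → k ≤ d → g k = h k * eigVec d q a' b' c k) {i : ℤ} (h0 : 0 ≤ i)
    (hi : i ≤ d) :
    tdOp q (q ^ d) a' b b' c g i =
      (tdSub q (q ^ d) c (q ^ i) * eigRatio q (q ^ d) a' b' c (q ^ i) * h (i - 1) +
        tdDiag q (q ^ d) a' b b' c (q ^ i) * h i -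
        (q ^ d / q ^ i - q ^ i / q ^ d) * (b - a' * c * (q ^ d * q / (q ^ i * q) ^ 2)) / q ^ i *
          h (i + 1)) * eigVec d q a' b' c i := by
  have hp : q ^ d ≠ 0 := pow_ne_zero _ hq
  have hr : q ^ i ≠ 0 := zpow_ne_zero _ hq
  have h1 : g (i - 1) = h (i - 1) * (eigRatio q (q ^ d) a' b' c (q ^ i) * eigVec d q a' b' c i) := by
    rcases eq_or_lt_of_le h0 with rfl | hpos
    · simp [hneg, eigRatio]
    · rw [hg _ (by omega) (by omega), eigVec_sub_one _ _ _ _ _ h0 hi]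
  have h2 : tdSup q (q ^ d) a' b b' c (q ^ (i + 1)) * g (i + 1) =
      -((q ^ d / q ^ i - q ^ i / q ^ d) * (b - a' * c * (q ^ d * q / (q ^ i * q) ^ 2)) / q ^ i) *
        h (i + 1) * eigVec d q a' b' c i := by
    rcases eq_or_lt_of_le hi with rfl | hlt
    · rw [zpow_add_one₀ hq, zpow_natCast, tdSup_mul hq hp]
      simp
    · have h3 := eigVec_sub_one d q a' b' c (k := i + 1) (by omega) (by omega)
      rw [add_sub_cancel_right] at h3
      rw [hg _ (by omega) (by omega), h3, zpow_add_one₀ hq, tdSup_eq a' b b' hq hp hc hr]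
      ring
  rw [tdOp, h1, h2, hg i h0 hi]
  ring

theorem tdMatrix_mulVec_eigVec {d : ℕ} {q c : F} (hq : q ≠ 0) (hc : c ≠ 0) (a' b b' : F) :
    tdMatrix d q a' b b' c *ᵥ finRestrict d (eigVec d q a' b' c) =
      lbEig (q ^ d) b b' (q ^ 0) • finRestrict d (eigVec d q a' b' c) := by
  rw [tdMatrix_mulVec d hq _ _ _ _ (eigVec_of_neg _ _ _ _ _)]
  ext i
  have hi : (((i : ℕ) : ℤ)) ≤ d := by omega
  simp only [finRestrict, Pi.smul_apply, smul_eq_mul]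
  rw [tdOp_mul_eigVec hq hc a' b b' _ (fun _ => 1) (eigVec_of_neg _ _ _ _ _ _ (by norm_num))
    (fun k _ _ => (one_mul _).symm) (by omega) hi, pow_zero,
    ← eigvec_identity a' b b' hq (pow_ne_zero d hq) hc (zpow_ne_zero ((i : ℕ) : ℤ) hq)]
  ring

theorem tdMatrix_mulVec_lbMatrix_mulVec_eigVec {d : ℕ} {q c : F} (hq : q ≠ 0) (hc : c ≠ 0)
    (a a' b b' : F) :
    ∃ κ : F, tdMatrix d q a' b b' c *ᵥ
        (lbMatrix d q a a' *ᵥ finRestrict d (eigVec d q a' b' c)) =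
      lbEig (q ^ d) b b' (q ^ 1) •
        (lbMatrix d q a a' *ᵥ finRestrict d (eigVec d q a' b' c)) +
      κ • finRestrict d (eigVec d q a' b' c) := by
  have hneg := eigVec_of_neg d q a' b' c
  have hlb := lbOp_of_neg hneg q (q ^ d) a a'
  have hlb' : ∀ k : ℤ, 0 ≤ k → k ≤ d → lbOp q (q ^ d) a a' (eigVec d q a' b' c) k =
      (lbEig (q ^ d) a a' (q ^ k) + eigRatio q (q ^ d) a' b' c (q ^ k)) *
        eigVec d q a' b' c k := fun k h0 hk => by
    rw [lbOp, eigVec_sub_one _ _ _ _ _ h0 hk, add_mul]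
  refine ⟨tdDiag q (q ^ d) a' b b' c 1 * lbEig (q ^ d) a a' 1
      - (q ^ d - 1 / q ^ d) * (b - a' * c * (q ^ d / q)) *
        (lbEig (q ^ d) a a' q + eigRatio q (q ^ d) a' b' c q)
      - lbEig (q ^ d) b b' q * lbEig (q ^ d) a a' 1, ?_⟩
  rw [lbMatrix_mulVec d _ _ _ hneg, tdMatrix_mulVec d hq _ _ _ _ hlb]
  ext i
  have hi : (((i : ℕ) : ℤ)) ≤ d := by omega
  have hi0 : 0 ≤ (((i : ℕ) : ℤ)) := by omega
  have key := krylov_identity a a' b b' hq (pow_ne_zero d hq) hc (zpow_ne_zero ((i : ℕ) : ℤ) hq)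
  simp only [finRestrict, Pi.smul_apply, smul_eq_mul, Pi.add_apply]
  rw [tdOp_mul_eigVec hq hc a' b b' _
    (fun k => lbEig (q ^ d) a a' (q ^ k) + eigRatio q (q ^ d) a' b' c (q ^ k))
    (hlb _ (by norm_num)) hlb' hi0 hi, hlb' _ hi0 hi, ← key, zpow_add_one₀ hq, zpow_sub_one₀ hq,
    pow_one, div_eq_mul_inv _ q]
  ring

theorem lbEig_add_two {q p : F} (hq : q ≠ 0) (hp : p ≠ 0) (b b' : F) (i : ℕ) :
    lbEig p b b' (q ^ (i + 2)) =
      (q ^ 2 + 1 / q ^ 2) * lbEig p b b' (q ^ (i + 1)) - lbEig p b b' (q ^ i) := by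
  have hr : q ^ i ≠ 0 := pow_ne_zero _ hq
  simp only [lbEig, pow_succ]
  field_simp
  ring

theorem tdMatrix_charpoly {d : ℕ} {q c : F} (hq : q ≠ 0) (hc : c ≠ 0) (a a' b b' : F)
    (hirr : IsJointlyIrreducible (lbMatrix d q a a') (tdMatrix d q a' b b' c)) :
    (tdMatrix d q a' b b' c).charpoly =
      ∏ i : Fin (d + 1), (X - C (lbEig (q ^ d) b b' (q ^ (i : ℕ)))) := by
  obtain ⟨κ, hκ⟩ := tdMatrix_mulVec_lbMatrix_mulVec_eigVec (d := d) hq hc a a' b b'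
  exact charpoly_eq_prod_of_aw (f := fun i => lbEig (q ^ d) b b' (q ^ i)) hirr
    (aw_lbMatrix_tdMatrix d hq hc a a' b b') (lbEig_add_two hq (pow_ne_zero d hq) b b')
    (eigVec_ne_zero d q a' b' c) (tdMatrix_mulVec_eigVec hq hc a' b b') hκ

theorem lbMatrix_charpoly (d : ℕ) (q a a' : F) :
    (lbMatrix d q a a').charpoly =
      ∏ i : Fin (d + 1), (X - C (lbEig (q ^ d) a a' (q ^ (i : ℕ)))) := by
  rw [← charpoly_transpose, charpoly_of_isUpperTriangular]
  · simp [lbMatrix, bandMatrix]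
  · intro i j hij
    have : (j : ℕ) < i := hij
    simp only [lbMatrix, bandMatrix, transpose_apply, of_apply]
    rw [if_neg (by omega), if_neg (by omega), Pi.zero_apply, ite_self]

theorem bandMatrix_eq_zero_of_first {d : ℕ} {x y z : ℤ → F}
    (hy : ∀ i : ℕ, 1 ≤ i → i ≤ d → y i ≠ 0) (hy' : y (d + 1) = 0) {t : F} {v : Fin (d + 1) → F}
    (hv : bandMatrix d x y z *ᵥ v = t • v) (h0 : v 0 = 0) : v = 0 := by
  have key : ∀ k : ℕ, ∀ l ≤ k, l ≤ d → zeroExtend v l = 0 := by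
    intro k
    induction k with
    | zero =>
      intro l hl _
      obtain rfl : l = 0 := by omega
      exact (zeroExtend_natCast v 0).trans h0
    | succ k ih =>
      intro l hl hld
      by_cases hlk : l ≤ k
      · exact ih l hlk hld
      obtain rfl : l = k + 1 := by omega
      have h1 := congrFun hv ⟨k, by omega⟩
      rw [← finRestrict_zeroExtend v,
        bandMatrix_mulVec _ _ _ _ (zeroExtend_of_neg v (by norm_num)) hy'] at h1
      have h2 : zeroExtend v ((k : ℤ) - 1) = 0 := by
        rcases k with _ | k
        · exact zeroExtend_of_neg v (by norm_num)
        · have := ih k (by omega) (by omega)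
          simpa using this
      simp only [Pi.smul_apply, finRestrict, h2, ih k le_rfl (by omega), smul_zero, mul_zero,
        zero_add, mul_eq_zero] at h1
      have h3 := hy (k + 1) (by omega) hld
      push_cast at h3 ⊢
      exact h1.resolve_left h3
  ext k
  rw [← zeroExtend_natCast v k]
  exact key k k le_rfl (by omega)

theorem bandMatrix_eq_zero_of_last {d : ℕ} {x y z : ℤ → F} (hy : ∀ i, y i = 0)
    (hz : ∀ i : ℕ, 1 ≤ i → i ≤ d → z i ≠ 0) {t : F} {v : Fin (d + 1) → F}
    (hv : bandMatrix d x y z *ᵥ v = t • v) (h0 : v (Fin.last d) = 0) : v = 0 := by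
  have key : ∀ k : ℕ, k ≤ d → zeroExtend v (d - k : ℕ) = 0 := by
    intro k
    induction k with
    | zero => exact fun _ => (zeroExtend_natCast v (Fin.last d)).trans h0
    | succ k ih =>
      intro hk
      have h1 := congrFun hv ⟨d - k, by omega⟩
      rw [← finRestrict_zeroExtend v,
        bandMatrix_mulVec _ _ _ _ (zeroExtend_of_neg v (by norm_num)) (hy _)] at h1
      simp only [Pi.smul_apply, finRestrict, ih (by omega), hy, smul_zero, mul_zero,
        zero_mul, add_zero, mul_eq_zero] at h1
      have h3 := hz (d - k) (by omega) (by omega)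
      have h4 : ((d - (k + 1) : ℕ) : ℤ) = (d - k : ℕ) - 1 := by omega
      rw [h4]
      exact h1.resolve_left h3
  ext k
  rw [← zeroExtend_natCast v k]
  have := key (d - k) (by omega)
  rwa [show d - (d - (k : ℕ)) = k by omega] at this

end Eigenvector

section SubdiagonalEntry

variable {F : Type*} [Field F]

theorem eigGap_add {d : ℕ} {q : F} (hq : q ≠ 0) (a a' : F) (n : ℤ) :
    (q - 1 / q) * (eigGap d q a a' (n + 1) + eigGap d q a a' (n - 1)) =
      (q ^ 2 - 1 / q ^ 2) * eigGap d q a a' n := by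
  have hn : q ^ n ≠ 0 := zpow_ne_zero _ hq
  have hd : q ^ d ≠ 0 := pow_ne_zero _ hq
  simp only [eigGap, zpow_sub_one₀ hq, zpow_add_one₀ hq]
  field_simp
  ring

theorem lbEig_sub_succ {d : ℕ} {q : F} (hq : q ≠ 0) (a a' : F) (j : ℤ) :
    lbEig (q ^ d) a a' (q ^ j) - lbEig (q ^ d) a a' (q ^ (j + 1)) =
      -((q - 1 / q) * eigGap d q a a' (2 * j + 1)) := by
  rw [lbEig_sub_lbEig hq, show j - (j + 1) = -1 by ring, show j + (j + 1) = 2 * j + 1 by ring,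
    zpow_neg_one]
  field_simp
  ring

theorem lbEig_sub_add_two {d : ℕ} {q : F} (hq : q ≠ 0) (a a' : F) (j : ℤ) :
    lbEig (q ^ d) a a' (q ^ j) - lbEig (q ^ d) a a' (q ^ (j + 2)) =
      -((q ^ 2 - 1 / q ^ 2) * eigGap d q a a' (2 * j + 2)) := by
  rw [lbEig_sub_lbEig hq, show j - (j + 2) = -2 by ring, show j + (j + 2) = 2 * j + 2 by ring,
    zpow_neg, zpow_ofNat]
  field_simp
  ring

/-- The subdiagonal entry, in an eigenbasis of a lower bidiagonal matrix, of a tridiagonal matrix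
with diagonal `x₀, x₁`, superdiagonal `y₀, y₁, y₂` and subdiagonal entry `z`. -/
def eigEntry (z x₀ x₁ y₀ y₁ y₂ α β α' β' : F) : F :=
  z + x₁ * α + y₂ * β - β' * y₀ - α * (x₀ + y₁ * α - α' * y₀)

theorem eigEntry_mul {k k₂ D₀ D₁ D₂ G : F} (hk : k ≠ 0) (hk₂ : k₂ ≠ 0) (h0 : D₀ ≠ 0) (h1 : D₁ ≠ 0)
    (h2 : D₂ ≠ 0) (hG : G ≠ 0) (h : k * (D₀ + G) = k₂ * D₁) (z x₀ x₁ y₀ y₁ y₂ : F) :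
    eigEntry z x₀ x₁ y₀ y₁ y₂ (-(k * D₀))⁻¹ ((-(k * D₀))⁻¹ * (-(k₂ * D₂))⁻¹) (-(k * G))⁻¹
        ((-(k * G))⁻¹ * (-(k₂ * D₁))⁻¹) * (k ^ 2 * k₂ * D₁ * D₀ ^ 2 * D₂) =
      z * (k ^ 2 * k₂ * D₁ * D₀ ^ 2 * D₂) - (x₁ - x₀) * (k * k₂ * D₁ * D₀ * D₂) -
        y₁ * (k₂ * D₁ * D₂) + y₂ * (k * D₁ * D₀) + y₀ * (k * D₂ * D₀) := by
  have e : (-(k * D₀))⁻¹ * (-(k * G))⁻¹ - (-(k * G))⁻¹ * (-(k₂ * D₁))⁻¹ =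
      (k * k₂ * D₀ * D₁)⁻¹ := by
    field_simp
    linear_combination -h
  have e' : eigEntry z x₀ x₁ y₀ y₁ y₂ (-(k * D₀))⁻¹ ((-(k * D₀))⁻¹ * (-(k₂ * D₂))⁻¹) (-(k * G))⁻¹
      ((-(k * G))⁻¹ * (-(k₂ * D₁))⁻¹) =
      z + x₁ * (-(k * D₀))⁻¹ + y₂ * ((-(k * D₀))⁻¹ * (-(k₂ * D₂))⁻¹) -
        (-(k * D₀))⁻¹ * (x₀ + y₁ * (-(k * D₀))⁻¹) + y₀ * (k * k₂ * D₀ * D₁)⁻¹ := by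
    rw [← e, eigEntry]
    ring
  rw [e']
  field_simp
  ring

theorem eigEntry_mul_left {k k₂ D₀ D₂ : F} (hk : k ≠ 0) (hk₂ : k₂ ≠ 0) (h0 : D₀ ≠ 0)
    (h2 : D₂ ≠ 0) (z x₀ x₁ y₁ y₂ α' β' : F) :
    eigEntry z x₀ x₁ 0 y₁ y₂ (-(k * D₀))⁻¹ ((-(k * D₀))⁻¹ * (-(k₂ * D₂))⁻¹) α' β' *
        (k ^ 2 * k₂ * D₀ ^ 2 * D₂) =
      z * (k ^ 2 * k₂ * D₀ ^ 2 * D₂) - (x₁ - x₀) * (k * k₂ * D₀ * D₂) -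
        y₁ * (k₂ * D₂) + y₂ * (k * D₀) := by
  simp only [eigEntry, mul_zero, sub_zero]
  field_simp
  ring

theorem eigEntry_mul_right {k k₂ D₀ D₁ G : F} (hk : k ≠ 0) (hk₂ : k₂ ≠ 0) (h0 : D₀ ≠ 0)
    (h1 : D₁ ≠ 0) (hG : G ≠ 0) (h : k * (D₀ + G) = k₂ * D₁) (z x₀ x₁ y₀ y₁ β : F) :
    eigEntry z x₀ x₁ y₀ y₁ 0 (-(k * D₀))⁻¹ β (-(k * G))⁻¹
        ((-(k * G))⁻¹ * (-(k₂ * D₁))⁻¹) * (k ^ 2 * k₂ * D₁ * D₀ ^ 2) =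
      z * (k ^ 2 * k₂ * D₁ * D₀ ^ 2) - (x₁ - x₀) * (k * k₂ * D₁ * D₀) -
        y₁ * (k₂ * D₁) + y₀ * (k * D₀) := by
  have := eigEntry_mul hk hk₂ h0 h1 one_ne_zero hG h z x₀ x₁ y₀ y₁ 0
  simp only [eigEntry, zero_mul, add_zero, mul_one] at this ⊢
  exact this

/-- The coefficient below the diagonal in the eigenbasis vanishes exactly for the excluded
values of `b` and `b'`. -/
theorem subdiag_eq_zero_iff {d : ℕ} (hd : 2 ≤ d) {q c : F} (hq : q ≠ 0)
    (hqru : ∀ n : ℕ, 1 ≤ n → q ^ n ≠ 1) (hc : c ≠ 0) {a a' : F} (hsep : IsSeparated d q a a')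
    (b b' : F) {j : ℤ} (h0 : 0 ≤ j) (hj : j < d) (t : F) (θ x y : ℤ → F)
    (hθ : ∀ i, θ i = lbEig (q ^ d) a a' (q ^ i))
    (hx : ∀ i, x i = tdDiag q (q ^ d) a' b b' c (q ^ i))
    (hy : ∀ i, y i = tdSup q (q ^ d) a' b b' c (q ^ i))
    (ht : t = eigEntry (tdSub q (q ^ d) c (q ^ (j + 1))) (x j) (x (j + 1)) (y j) (y (j + 1))
      (y (j + 2)) (θ j - θ (j + 1))⁻¹ ((θ j - θ (j + 1))⁻¹ * (θ j - θ (j + 2))⁻¹)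
      (θ (j - 1) - θ j)⁻¹ ((θ (j - 1) - θ j)⁻¹ * (θ (j - 1) - θ (j + 1))⁻¹)) :
    t = 0 ↔ (b - a * c * ((q ^ j) ^ 2 * q / q ^ d)) * (b' - a * c * ((q ^ j) ^ 2 * q / q ^ d)) = 0 := by
  have hp : q ^ d ≠ 0 := pow_ne_zero _ hq
  have hr : q ^ j ≠ 0 := zpow_ne_zero _ hq
  have hk : q - 1 / q ≠ 0 := by simpa using zpow_sub_inv_ne_zero hq hqru one_ne_zero
  have hk2 : q ^ 2 - 1 / q ^ 2 ≠ 0 := by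
    simpa only [zpow_ofNat] using zpow_sub_inv_ne_zero hq hqru two_ne_zero
  have g0 : θ j - θ (j + 1) = -((q - 1 / q) * eigGap d q a a' (2 * j + 1)) := by
    rw [hθ, hθ, lbEig_sub_succ hq]
  have g2 : θ j - θ (j + 2) = -((q ^ 2 - 1 / q ^ 2) * eigGap d q a a' (2 * j + 2)) := by
    rw [hθ, hθ, lbEig_sub_add_two hq]
  have gm : θ (j - 1) - θ j = -((q - 1 / q) * eigGap d q a a' (2 * j - 1)) := by
    have := lbEig_sub_succ (d := d) hq a a' (j - 1)
    rw [sub_add_cancel] at this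
    rw [hθ, hθ, this]
    ring_nf
  have g1 : θ (j - 1) - θ (j + 1) = -((q ^ 2 - 1 / q ^ 2) * eigGap d q a a' (2 * j)) := by
    have := lbEig_sub_add_two (d := d) hq a a' (j - 1)
    rw [show j - 1 + 2 = j + 1 by ring] at this
    rw [hθ, hθ, this]
    ring_nf
  have hgap := eigGap_add (d := d) hq a a' (2 * j)
  have e0 : eigGap d q a a' (2 * j + 1) =
      a * q * (q ^ j) ^ 2 / q ^ d - a' * q ^ d / (q * (q ^ j) ^ 2) := by
    rw [eigGap, zpow_add_one₀ hq, mul_comm 2 j, zpow_mul, zpow_ofNat]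
    ring
  have e1 : eigGap d q a a' (2 * j) = a * (q ^ j) ^ 2 / q ^ d - a' * q ^ d / (q ^ j) ^ 2 := by
    rw [eigGap, mul_comm 2 j, zpow_mul, zpow_ofNat]
  have e2 : eigGap d q a a' (2 * j + 2) =
      a * q ^ 2 * (q ^ j) ^ 2 / q ^ d - a' * q ^ d / (q ^ 2 * (q ^ j) ^ 2) := by
    rw [eigGap, zpow_add₀ hq, mul_comm 2 j, zpow_mul, zpow_ofNat, zpow_ofNat]
    ring
  have n0 := hsep.eigGap_ne_zero hq (n := 2 * j + 1) (by omega) (by omega)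
  have f1 : a * q ^ j / q ^ d - a' * q ^ d / q ^ j = eigGap d q a a' j := rfl
  have f2 : a * q * q ^ j - a' / (q * q ^ j) = eigGap d q a a' (j + 1 + d) := by
    rw [eigGap, zpow_add₀ hq, zpow_add_one₀ hq, zpow_natCast]
    field_simp
  rw [g0, g1, g2, gm] at ht
  clear g0 g1 g2 gm
  have x1 : x (j + 1) = tdDiag q (q ^ d) a' b b' c (q ^ j * q) := by rw [hx, zpow_add_one₀ hq]
  have y1 : y (j + 1) = tdSup q (q ^ d) a' b b' c (q ^ j * q) := by rw [hy, zpow_add_one₀ hq]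
  have y2 : y (j + 2) = tdSup q (q ^ d) a' b b' c (q ^ j * q ^ 2) := by
    rw [hy, zpow_add₀ hq, zpow_ofNat]
  rw [zpow_add_one₀ hq, x1, y1, y2, hx j, hy j] at ht
  clear x1 y1 y2 hx hy hθ
  have close : ∀ {L R B : F}, t * L = R * B → L ≠ 0 → R ≠ 0 → (t = 0 ↔ B = 0) := by
    intro L R B h hL hR
    rw [← mul_eq_zero_iff_right hL, h, mul_eq_zero_iff_left hR]
  have hc' : -(1 / c) ≠ 0 := neg_ne_zero.2 (one_div_ne_zero hc)
  have hkk : (q - 1 / q) ^ 2 * (q ^ 2 - 1 / q ^ 2) ≠ 0 := mul_ne_zero (pow_ne_zero 2 hk) hk2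
  rcases eq_or_lt_of_le h0 with hj0 | hj0
  · have n2 := hsep.eigGap_ne_zero hq (n := 2 * j + 2) (by omega) (by omega)
    have m2 := hsep.eigGap_ne_zero hq (n := j + 1 + d) (by omega) (by omega)
    subst hj0
    simp only [zpow_zero, tdSup_one, one_mul, mul_one, one_pow] at ht e0 e2 f2 ⊢
    have key := subdiag_identity_left a a' b b' hq hp hc _ _ e0 e2
    rw [f2, ← eigEntry_mul_left hk hk2 n0 n2, ← ht] at key
    refine close (R := -(1 / c) * eigGap d q a a' (0 + 1 + d) * _) (key.trans ?_)
      (mul_ne_zero (mul_ne_zero hkk (pow_ne_zero 2 n0)) n2) (mul_ne_zero (mul_ne_zero hc' m2) hkk)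
    ring
  have n1 := hsep.eigGap_ne_zero hq (n := 2 * j) (by omega) (by omega)
  have nG := hsep.eigGap_ne_zero hq (n := 2 * j - 1) (by omega) (by omega)
  have m1 := hsep.eigGap_ne_zero hq (n := j) (by omega) (by omega)
  rcases eq_or_lt_of_le (Int.add_one_le_of_lt hj) with hjd | hjd
  · have hpr : q ^ d = q ^ j * q := by rw [← zpow_add_one₀ hq, hjd, zpow_natCast]
    have hy2 : tdSup q (q ^ d) a' b b' c (q ^ j * q ^ 2) = 0 := by
      rw [show q ^ j * q ^ 2 = q ^ d * q by rw [hpr]; ring, tdSup_mul hq hp]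
    rw [hy2, ← hpr] at ht
    have key := subdiag_identity_right (r := q ^ j) a a' b b' hq hc hr
      (eigGap d q a a' (2 * j)) (eigGap d q a a' (2 * j + 1))
      (by rw [e1, hpr]; field_simp) (by rw [e0, hpr]; field_simp)
    rw [← hpr, ← eigEntry_mul_right hk hk2 n0 n1 nG hgap _ _ _ _ _
      ((-((q - 1 / q) * eigGap d q a a' (2 * j + 1)))⁻¹ *
        (-((q ^ 2 - 1 / q ^ 2) * eigGap d q a a' (2 * j + 2)))⁻¹), ← ht,
      show a / q - a' * q = eigGap d q a a' j by rw [← f1, hpr]; field_simp] at key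
    refine close (R := -(1 / c) * eigGap d q a a' j * _) (key.trans ?_)
      (mul_ne_zero (mul_ne_zero hkk n1) (pow_ne_zero 2 n0)) (mul_ne_zero (mul_ne_zero hc' m1) hkk)
    rw [show (q ^ j) ^ 2 * q / q ^ d = q ^ j by rw [hpr]; field_simp]
    ring
  · have n2 := hsep.eigGap_ne_zero hq (n := 2 * j + 2) (by omega) (by omega)
    have m2 := hsep.eigGap_ne_zero hq (n := j + 1 + d) (by omega) (by omega)
    have key := subdiag_identity a a' b b' hq hp hc hr _ _ _ e1 e0 e2
    rw [f1, f2, ← eigEntry_mul hk hk2 n0 n1 n2 nG hgap, ← ht] at key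
    refine close (R := -(1 / c) * (eigGap d q a a' j * eigGap d q a a' (j + 1 + d)) * _)
      (key.trans ?_) (mul_ne_zero (mul_ne_zero (mul_ne_zero hkk n1) (pow_ne_zero 2 n0)) n2)
      (mul_ne_zero (mul_ne_zero hc' (mul_ne_zero m1 m2)) hkk)
    ring

end SubdiagonalEntry

section EigenBasis

open Matrix

variable {F : Type*} [Field F]

/-- An eigenvector of the lower bidiagonal matrix with diagonal `θ`, as a bi-infinite sequence. -/
noncomputable def eigCol (θ : ℤ → F) (j k : ℤ) : F :=
  if k < j then 0 else ∏ l ∈ Finset.Ioc j k, (θ j - θ l)⁻¹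

theorem eigCol_of_lt (θ : ℤ → F) {j k : ℤ} (h : k < j) : eigCol θ j k = 0 := if_pos h

theorem eigCol_self (θ : ℤ → F) (j : ℤ) : eigCol θ j j = 1 := by simp [eigCol]

theorem eigCol_add_one (θ : ℤ → F) {j k : ℤ} (h : j ≤ k) :
    eigCol θ j (k + 1) = eigCol θ j k * (θ j - θ (k + 1))⁻¹ := by
  have hins : Finset.Ioc j (k + 1) = insert (k + 1) (Finset.Ioc j k) := by
    ext l
    simp only [Finset.mem_Ioc, Finset.mem_insert]
    omega
  rw [eigCol, eigCol, if_neg (by omega), if_neg (by omega), hins, Finset.prod_insert (by simp),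
    mul_comm]

theorem lbOp_eigCol {q p a a' : F} {j k : ℤ}
    (hθ : j < k → lbEig p a a' (q ^ j) ≠ lbEig p a a' (q ^ k)) :
    lbOp q p a a' (eigCol (fun i => lbEig p a a' (q ^ i)) j) k =
      lbEig p a a' (q ^ j) * eigCol (fun i => lbEig p a a' (q ^ i)) j k := by
  rw [lbOp]
  rcases lt_trichotomy k j with h | rfl | h
  · rw [eigCol_of_lt _ h, eigCol_of_lt _ (by omega)]
    simp
  · rw [eigCol_of_lt _ (by omega : k - 1 < k), add_zero]
  · have := eigCol_add_one (fun i => lbEig p a a' (q ^ i)) (by omega : j ≤ k - 1)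
    rw [sub_add_cancel] at this
    rw [this]
    have h' := sub_ne_zero.2 (hθ h)
    field_simp
    ring

/-- In an eigenbasis of the lower bidiagonal matrix, the tridiagonal matrix stays tridiagonal,
with known off-diagonal entries. -/
theorem exists_eigenbasis {d : ℕ} (hd : 2 ≤ d) {q c : F} (hq : q ≠ 0)
    (hqru : ∀ n : ℕ, 1 ≤ n → q ^ n ≠ 1) (hc : c ≠ 0) {a a' : F} (hsep : IsSeparated d q a a')
    (b b' : F) :
    ∃ Q : Matrix (Fin (d + 1)) (Fin (d + 1)) F, IsUnit Q ∧
      Q⁻¹ * lbMatrix d q a a' * Q = diagonal (fun i : Fin (d + 1) => lbEig (q ^ d) a a' (q ^ (i : ℕ))) ∧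
      IsTridiagonal (Q⁻¹ * tdMatrix d q a' b b' c * Q) ∧
      (∀ i j : Fin (d + 1), (j : ℕ) = i + 1 → (Q⁻¹ * tdMatrix d q a' b b' c * Q) i j =
        tdSup q (q ^ d) a' b b' c (q ^ (j : ℕ))) ∧
      (∀ i j : Fin (d + 1), (i : ℕ) = j + 1 → ((Q⁻¹ * tdMatrix d q a' b b' c * Q) i j = 0 ↔
        (b - a * c * ((q ^ (j : ℕ)) ^ 2 * q / q ^ d)) *
          (b' - a * c * ((q ^ (j : ℕ)) ^ 2 * q / q ^ d)) = 0)) := by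
  let θ : ℤ → F := fun i => lbEig (q ^ d) a a' (q ^ i)
  let Q : Matrix (Fin (d + 1)) (Fin (d + 1)) F := of fun k j => eigCol θ (j : ℕ) (k : ℕ)
  have hQdet : Q.det = 1 := by
    rw [det_of_isLowerTriangular]
    · simp [Q, eigCol_self]
    · intro i j hij
      have : (i : ℕ) < j := hij
      exact eigCol_of_lt _ (by omega)
  have hQ : IsUnit Q := (Matrix.isUnit_iff_isUnit_det Q).2 (by simp [hQdet])
  have hdet := (Matrix.isUnit_iff_isUnit_det Q).1 hQ
  have hneg : ∀ j : Fin (d + 1), ∀ k < 0, eigCol θ (j : ℕ) k = 0 := fun j k hk =>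
    eigCol_of_lt _ (by omega)
  have hAQ : lbMatrix d q a a' * Q =
      Q * diagonal (fun i : Fin (d + 1) => lbEig (q ^ d) a a' (q ^ (i : ℕ))) := by
    ext k j
    have h1 : (lbMatrix d q a a' * Q) k j =
        (lbMatrix d q a a' *ᵥ finRestrict d (eigCol θ (j : ℕ))) k := rfl
    rw [h1, lbMatrix_mulVec _ _ _ _ (hneg j), mul_diagonal, finRestrict, lbOp_eigCol, mul_comm,
      zpow_natCast]
    · rfl
    · intro hlt
      exact hsep.lbEig_ne hq hqru (by omega) (by omega) (by omega)
  have hconj : Q⁻¹ * lbMatrix d q a a' * Q =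
      diagonal (fun i : Fin (d + 1) => lbEig (q ^ d) a a' (q ^ (i : ℕ))) := by
    rw [mul_assoc, hAQ, nonsing_inv_mul_cancel_left _ _ hdet]
  have htri := isTridiagonal_of_aw hQ hconj (aw_lbMatrix_tdMatrix d hq hc a a' b b')
    (hsep.aw_factor_ne_zero hq hqru)
  have hBQ : Q * (Q⁻¹ * tdMatrix d q a' b b' c * Q) = tdMatrix d q a' b b' c * Q := by
    rw [mul_assoc, mul_nonsing_inv_cancel_left _ _ hdet]
  refine ⟨Q, hQ, hconj, htri, ?_⟩
  generalize Q⁻¹ * tdMatrix d q a' b b' c * Q = T at htri hBQ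
  have hrow : ∀ (j : Fin (d + 1)) (k : ℤ), 0 ≤ k → k ≤ d →
      eigCol θ ((j : ℕ) - 1) k * zeroExtend (T.col j) ((j : ℕ) - 1) +
        eigCol θ (j : ℕ) k * zeroExtend (T.col j) (j : ℕ) +
        eigCol θ ((j : ℕ) + 1) k * zeroExtend (T.col j) ((j : ℕ) + 1) =
      tdOp q (q ^ d) a' b b' c (eigCol θ (j : ℕ)) k := by
    intro j k hk0 hkd
    obtain ⟨k, rfl⟩ := Int.eq_ofNat_of_zero_le hk0
    let k' : Fin (d + 1) := ⟨k, by omega⟩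
    have h1 : (tdMatrix d q a' b b' c * Q) k' j =
        (tdMatrix d q a' b b' c *ᵥ finRestrict d (eigCol θ (j : ℕ))) k' := rfl
    rw [tdMatrix_mulVec _ hq _ _ _ _ (hneg j), ← hBQ] at h1
    refine Eq.trans ?_ h1
    have h2 := sum_fin_eq_three (d := d) (j := j) (by omega)
      (fun m => eigCol θ m k * zeroExtend (T.col j) m) ?_ ?_ ?_
    · rw [← h2, mul_apply]
      refine Finset.sum_congr rfl fun m _ => ?_
      rw [zeroExtend_natCast]
      rfl
    · intro m m1 m2 m3
      by_cases hm : 0 ≤ m ∧ m ≤ d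
      · obtain ⟨m, rfl⟩ := Int.eq_ofNat_of_zero_le hm.1
        have h3 := zeroExtend_natCast (T.col j) ⟨m, by omega⟩
        simp only at h3
        rw [h3, col_apply, htri _ _ (by simp only; omega), mul_zero]
      · rw [zeroExtend, dif_neg hm, mul_zero]
    · rw [zeroExtend_of_neg _ (by norm_num), mul_zero]
    · rw [zeroExtend_of_lt _ (by omega), mul_zero]
  have hcol : ∀ i j : Fin (d + 1), zeroExtend (T.col j) (i : ℕ) = T i j := fun i j =>
    zeroExtend_natCast _ i
  have hsup : ∀ j : Fin (d + 1), zeroExtend (T.col j) ((j : ℕ) - 1) =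
      tdSup q (q ^ d) a' b b' c (q ^ ((j : ℕ) : ℤ)) := by
    intro j
    rcases Nat.eq_zero_or_pos (j : ℕ) with h | h
    · rw [h, zeroExtend_of_neg _ (by norm_num)]
      simp [tdSup_one]
    · have h1 := hrow j ((j : ℕ) - 1) (by omega) (by omega)
      rw [tdOp, eigCol_self, eigCol_of_lt _ (by omega), eigCol_of_lt _ (by omega),
        eigCol_of_lt _ (by omega), sub_add_cancel, eigCol_self] at h1
      simpa using h1
  have hdiag : ∀ j : Fin (d + 1), zeroExtend (T.col j) (j : ℕ) =
      tdDiag q (q ^ d) a' b b' c (q ^ ((j : ℕ) : ℤ)) +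
      tdSup q (q ^ d) a' b b' c (q ^ (((j : ℕ) : ℤ) + 1)) * (θ (j : ℕ) - θ ((j : ℕ) + 1))⁻¹ -
      (θ ((j : ℕ) - 1) - θ (j : ℕ))⁻¹ * tdSup q (q ^ d) a' b b' c (q ^ ((j : ℕ) : ℤ)) := by
    intro j
    have h1 := hrow j (j : ℕ) (by omega) (by omega)
    have h2 := eigCol_add_one θ (le_refl (((j : ℕ) : ℤ) - 1))
    rw [sub_add_cancel, eigCol_self, one_mul] at h2
    rw [tdOp, eigCol_self, eigCol_of_lt θ (by omega : ((j : ℕ) : ℤ) < (j : ℕ) + 1),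
      eigCol_of_lt θ (by omega : ((j : ℕ) : ℤ) - 1 < (j : ℕ)), eigCol_add_one θ (le_refl _),
      eigCol_self, h2, hsup] at h1
    linear_combination h1
  constructor
  · intro i j hij
    have h1 := hsup j
    rw [show (((j : ℕ) : ℤ) - 1) = (i : ℕ) by omega, hcol] at h1
    rw [h1, zpow_natCast]
  · intro i j hij
    rw [← zpow_natCast q (j : ℕ)]
    refine subdiag_eq_zero_iff hd hq hqru hc hsep b b' (by omega) (by omega) (T i j) θ
      (fun i => tdDiag q (q ^ d) a' b b' c (q ^ i)) (fun i => tdSup q (q ^ d) a' b b' c (q ^ i))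
      (fun _ => rfl) (fun _ => rfl) (fun _ => rfl) ?_
    have h1 := hrow j ((j : ℕ) + 1) (by omega) (by omega)
    have h2 := eigCol_add_one θ (le_refl (((j : ℕ) : ℤ) - 1))
    rw [sub_add_cancel, eigCol_self, one_mul] at h2
    have h3 := eigCol_add_one θ (by omega : ((j : ℕ) : ℤ) - 1 ≤ (j : ℕ))
    have h4 := eigCol_add_one θ (le_refl ((j : ℕ) : ℤ))
    have h5 := eigCol_add_one θ (by omega : ((j : ℕ) : ℤ) ≤ (j : ℕ) + 1)
    rw [h2] at h3
    rw [eigCol_self, one_mul] at h4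
    rw [tdOp, add_sub_cancel_right, eigCol_self, eigCol_self, h5, h4, h3, hsup, hdiag,
      show (((j : ℕ) : ℤ) + 1) = (i : ℕ) by omega, hcol] at h1
    rw [eigEntry]
    simp only [show (((j : ℕ) : ℤ) + 2) = (i : ℕ) + 1 by omega,
      show (((j : ℕ) : ℤ) + 1) = (i : ℕ) by omega]
    linear_combination h1

end EigenBasis

section LeonardPairs

open Matrix

variable {F : Type*} [Field F]

theorem isIrredTridiagonal_bandMatrix_iff {d : ℕ} {x y z : ℤ → F} :
    IsIrredTridiagonal (bandMatrix d x y z) ↔ ∀ i : ℕ, 1 ≤ i → i ≤ d → y i ≠ 0 ∧ z i ≠ 0 := by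
  constructor
  · intro h i h1 hi
    have hy := h.2 ⟨i - 1, by omega⟩ ⟨i, by omega⟩ (Or.inr (by simp only; omega))
    have hz := h.2 ⟨i, by omega⟩ ⟨i - 1, by omega⟩ (Or.inl (by simp only; omega))
    simp only [bandMatrix, of_apply] at hy hz
    rw [if_neg (by omega), if_neg (by omega), if_pos (by omega)] at hy
    rw [if_neg (by omega), if_pos (by omega)] at hz
    exact ⟨hy, hz⟩
  · intro h
    refine ⟨fun i j hij => ?_, fun i j hij => ?_⟩
    · simp only [bandMatrix, of_apply]
      rw [if_neg (by omega), if_neg (by omega), if_neg (by omega)]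
    · simp only [bandMatrix, of_apply]
      rcases hij with hij | hij
      · rw [if_neg (by omega), if_pos hij]
        exact (h i (by omega) (by omega)).2
      · rw [if_neg (by omega), if_neg (by omega), if_pos hij]
        exact (h j (by omega) (by omega)).1

theorem tdSub_ne_zero {q p c r : F} (hq : q ≠ 0) (hp : p ≠ 0) (hc : c ≠ 0) (hr : r ≠ 0) :
    tdSub q p c r ≠ 0 := by
  simp [tdSub, hq, hp, hc, hr]

theorem tdSup_ne_zero_iff {d : ℕ} {q c : F} (hq : q ≠ 0) (hqru : ∀ n : ℕ, 1 ≤ n → q ^ n ≠ 1)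
    (hc : c ≠ 0) (a' b b' : F) {j : ℕ} (h1 : 1 ≤ j) (hj : j ≤ d) :
    tdSup q (q ^ d) a' b b' c (q ^ j) ≠ 0 ↔
      (b - a' * c * (q ^ d * q / (q ^ j) ^ 2)) * (b' - a' * c * (q ^ d * q / (q ^ j) ^ 2)) ≠ 0 := by
  have e1 : q ^ j - 1 / q ^ j ≠ 0 := by
    simpa only [zpow_natCast] using zpow_sub_inv_ne_zero hq hqru (m := j) (by omega)
  have e2 : q ^ d * q / q ^ j - q ^ j / (q ^ d * q) ≠ 0 := by
    have := zpow_sub_inv_ne_zero hq hqru (m := d + 1 - j) (by omega)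
    rwa [_root_.zpow_sub₀ hq, _root_.zpow_add_one₀ hq, zpow_natCast, zpow_natCast,
      one_div_div] at this
  simp only [tdSup, ne_eq, div_eq_zero_iff, mul_eq_zero, e1, e2, hc, false_or, or_false]

theorem isIrredTridiagonal_tdMatrix_iff {d : ℕ} {q c : F} (hq : q ≠ 0)
    (hqru : ∀ n : ℕ, 1 ≤ n → q ^ n ≠ 1) (hc : c ≠ 0) (a' b b' : F) :
    IsIrredTridiagonal (tdMatrix d q a' b b' c) ↔ ∀ j : ℕ, 1 ≤ j → j ≤ d →
      (b - a' * c * (q ^ d * q / (q ^ j) ^ 2)) *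
        (b' - a' * c * (q ^ d * q / (q ^ j) ^ 2)) ≠ 0 := by
  rw [tdMatrix, isIrredTridiagonal_bandMatrix_iff]
  refine forall_congr' fun j => forall_congr' fun h1 => forall_congr' fun hj => ?_
  rw [zpow_natCast, tdSup_ne_zero_iff hq hqru hc a' b b' h1 hj, and_iff_left]
  exact tdSub_ne_zero hq (pow_ne_zero _ hq) hc (pow_ne_zero _ hq)

theorem IsJointlyIrreducible.symm {n : ℕ} {A B : Matrix (Fin n) (Fin n) F}
    (h : IsJointlyIrreducible A B) : IsJointlyIrreducible B A :=
  fun W hB hA => h W hA hB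

/-- The characterization of the Leonard pairs among the normalized pairs. -/
theorem isLeonardPair_lbMatrix_tdMatrix_iff {d : ℕ} (hd : 2 ≤ d) {q c : F} (hq : q ≠ 0)
    (hqru : ∀ n : ℕ, 1 ≤ n → q ^ n ≠ 1) (hc : c ≠ 0) (a a' b b' : F) :
    (IsIrredTridiagonal (tdMatrix d q a' b b' c) ∧
      IsLeonardPair (lbMatrix d q a a') (tdMatrix d q a' b b' c)) ↔
    (IsSeparated d q a a' ∧ IsSeparated d q b b' ∧
      (∀ j : ℕ, 1 ≤ j → j ≤ d → (b - a' * c * (q ^ d * q / (q ^ j) ^ 2)) *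
        (b' - a' * c * (q ^ d * q / (q ^ j) ^ 2)) ≠ 0) ∧
      ∀ j : ℕ, j < d → (b - a * c * ((q ^ j) ^ 2 * q / q ^ d)) *
        (b' - a * c * ((q ^ j) ^ 2 * q / q ^ d)) ≠ 0) := by
  rw [isIrredTridiagonal_tdMatrix_iff hq hqru hc]
  constructor
  · rintro ⟨hB, ⟨P, hP, -, hPB⟩, ⟨Q, hQ, hQB, hQA⟩⟩
    rw [isDiag_iff_diagonal_diag] at hPB hQA
    have hinjA := diagonal_injective_of_conj (Fin.last d)
      (fun t v hv h0 => bandMatrix_eq_zero_of_last (fun _ => rfl) (fun _ _ _ => one_ne_zero) hv h0)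
      hQ hQA.symm
    have hsepA : IsSeparated d q a a' := isSeparated_of_injective hq
      (injective_of_charpoly_eq hQ hQA.symm hinjA (lbMatrix_charpoly d q a a'))
    have hirr : IsJointlyIrreducible (lbMatrix d q a a') (tdMatrix d q a' b b' c) := by
      refine IsJointlyIrreducible.of_conj hQ ?_
      rw [← hQA]
      exact IsJointlyIrreducible.of_diagonal hinjA hQB
    have hy' : tdSup q (q ^ d) a' b b' c (q ^ ((d : ℤ) + 1)) = 0 := by
      rw [_root_.zpow_add_one₀ hq, zpow_natCast, tdSup_mul hq (pow_ne_zero _ hq)]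
    have hinjB := diagonal_injective_of_conj 0
      (fun t v hv h0 => bandMatrix_eq_zero_of_first (fun i h1 hi => by
        rw [zpow_natCast]
        exact (tdSup_ne_zero_iff hq hqru hc a' b b' h1 hi).2 (hB i h1 hi)) hy' hv h0)
      hP hPB.symm
    have hsepB : IsSeparated d q b b' := isSeparated_of_injective hq
      (injective_of_charpoly_eq hP hPB.symm hinjB (tdMatrix_charpoly hq hc a a' b b' hirr))
    obtain ⟨R, hR, hRA, hRB, -, hsub⟩ := exists_eigenbasis hd hq hqru hc hsepA b b'
    have hT := hirr.conj hR
    rw [hRA] at hT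
    have hT' := hT.isIrredTridiagonal hRB
    refine ⟨hsepA, hsepB, hB, fun j hj h0 => ?_⟩
    exact hT'.2 ⟨j + 1, by omega⟩ ⟨j, by omega⟩ (Or.inl rfl) ((hsub _ _ rfl).2 h0)
  · rintro ⟨hsepA, hsepB, hB, hT⟩
    obtain ⟨R, hR, hRA, hRB, hsup, hsub⟩ := exists_eigenbasis hd hq hqru hc hsepA b b'
    have hRirr : IsIrredTridiagonal (R⁻¹ * tdMatrix d q a' b b' c * R) := by
      refine ⟨hRB, fun i j hij => ?_⟩
      rcases hij with hij | hij
      · exact fun h0 => hT j (by omega) ((hsub i j hij).1 h0)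
      · rw [hsup i j hij]
        exact (tdSup_ne_zero_iff hq hqru hc a' b b' (by omega) (by omega)).2
          (hB j (by omega) (by omega))
    have hirr : IsJointlyIrreducible (lbMatrix d q a a') (tdMatrix d q a' b b' c) := by
      refine IsJointlyIrreducible.of_conj hR ?_
      rw [hRA]
      exact IsJointlyIrreducible.of_diagonal (hsepA.injective hq hqru) hRirr
    obtain ⟨P, hP, hPB⟩ := exists_diagonalizing (hsepB.injective hq hqru)
      (tdMatrix_charpoly hq hc a a' b b' hirr)
    have hPA := isTridiagonal_of_aw hP hPB (aw_tdMatrix_lbMatrix d hq hc a a' b b')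
      (hsepB.aw_factor_ne_zero hq hqru)
    have hP' := (hirr.conj hP).symm
    rw [hPB] at hP'
    refine ⟨hB, ⟨P, hP, hP'.isIrredTridiagonal hPA, ?_⟩, R, hR, hRirr, ?_⟩
    · rw [hPB]
      exact isDiag_diagonal _
    · rw [hRA]
      exact isDiag_diagonal _

theorem isIrredTridiagonal_add_smul_one {n : ℕ} {M : Matrix (Fin n) (Fin n) F}
    (hM : IsIrredTridiagonal M) (s : F) : IsIrredTridiagonal (M + s • 1) := by
  have hoff : ∀ i j : Fin n, (i : ℕ) ≠ j → (M + s • 1) i j = M i j := by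
    intro i j hij
    simp [one_apply_ne (fun h => hij (congrArg Fin.val h) : i ≠ j)]
  refine ⟨fun i j hij => ?_, fun i j hij => ?_⟩
  · rw [hoff _ _ (by omega)]
    exact hM.1 i j hij
  · rw [hoff _ _ (by omega)]
    exact hM.2 i j hij

theorem isIrredTridiagonal_add_smul_one_iff {n : ℕ} {M : Matrix (Fin n) (Fin n) F} (s : F) :
    IsIrredTridiagonal (M + s • 1) ↔ IsIrredTridiagonal M := by
  refine ⟨fun h => ?_, fun h => isIrredTridiagonal_add_smul_one h s⟩
  have := isIrredTridiagonal_add_smul_one h (-s)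
  simpa only [neg_smul, add_neg_cancel_right] using this

theorem isLeonardPair_add_smul_one {n : ℕ} {A B : Matrix (Fin n) (Fin n) F}
    (h : IsLeonardPair A B) (s t : F) : IsLeonardPair (A + s • 1) (B + t • 1) := by
  have hconj : ∀ {M P : Matrix (Fin n) (Fin n) F}, IsUnit P → ∀ s : F,
      P⁻¹ * (M + s • 1) * P = P⁻¹ * M * P + s • 1 := by
    intro M P hP s
    rw [mul_add, add_mul, mul_smul_comm, mul_one, smul_mul_assoc,
      nonsing_inv_mul _ ((Matrix.isUnit_iff_isUnit_det P).1 hP)]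
  have hdiag : ∀ {M : Matrix (Fin n) (Fin n) F}, M.IsDiag → ∀ s : F, (M + s • 1).IsDiag :=
    fun hM s => hM.add (isDiag_one.smul s)
  obtain ⟨⟨P, hP, hPA, hPB⟩, Q, hQ, hQB, hQA⟩ := h
  refine ⟨⟨P, hP, ?_, ?_⟩, Q, hQ, ?_, ?_⟩
  · rw [hconj hP]
    exact isIrredTridiagonal_add_smul_one hPA s
  · rw [hconj hP]
    exact hdiag hPB t
  · rw [hconj hQ]
    exact isIrredTridiagonal_add_smul_one hQB t
  · rw [hconj hQ]
    exact hdiag hQA s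

theorem isLeonardPair_add_smul_one_iff {n : ℕ} {A B : Matrix (Fin n) (Fin n) F} (s t : F) :
    IsLeonardPair (A + s • 1) (B + t • 1) ↔ IsLeonardPair A B := by
  refine ⟨fun h => ?_, fun h => isLeonardPair_add_smul_one h s t⟩
  have := isLeonardPair_add_smul_one h (-s) (-t)
  simpa only [neg_smul, add_neg_cancel_right] using this

end LeonardPairs

section Exponents

variable {F : Type*} [Field F]

theorem zpow_sub_two_mul {q : F} (hq : q ≠ 0) (d i : ℤ) :
    q ^ (d - 2 * i) = q ^ d / (q ^ i) ^ 2 := by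
  rw [zpow_sub₀ hq, mul_comm 2 i, zpow_mul, zpow_ofNat]

theorem zpow_two_mul_sub {q : F} (hq : q ≠ 0) (i d : ℤ) :
    q ^ (2 * i - d) = (q ^ i) ^ 2 / q ^ d := by
  rw [zpow_sub₀ hq, mul_comm 2 i, zpow_mul, zpow_ofNat]

theorem pow_sub_sq_mul_div {q : F} (hq : q ≠ 0) {d j : ℕ} (hj : j ≤ d) :
    (q ^ (d - j)) ^ 2 * q / q ^ d = q ^ d * q / (q ^ j) ^ 2 := by
  obtain ⟨m, rfl⟩ := Nat.exists_eq_add_of_le hj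
  rw [Nat.add_sub_cancel_left, pow_add]
  field_simp

theorem isSeparated_iff {d : ℕ} {q a a' : F} :
    IsSeparated d q a a' ↔
      ∀ j : ℕ, 1 ≤ j → j ≤ 2 * d - 1 → a ≠ a' * q ^ (2 * (d : ℤ) - 2 * (j : ℤ)) := by
  constructor
  · intro h j h1 h2
    exact h j (by omega) (by omega)
  · intro h n h1 h2
    obtain ⟨m, rfl⟩ := Int.eq_ofNat_of_zero_le (by omega : 0 ≤ n)
    exact h m (by omega) (by omega)

end Exponents

/-- Proposition 1.6 of the paper: the LB-TD pair built from the scalars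
`α, αs, a, a', b, b', c` is a Leonard pair iff the inequalities (C1)-(C3) hold. -/
theorem stmt0 {F : Type*} [Field F] [IsAlgClosed F] {d : ℕ} (hd : 3 ≤ d)
    (q α αs a a' b b' c : F) (hq : q ≠ 0)
    (hqru : ∀ n : ℕ, 1 ≤ n → q ^ n ≠ 1) (hc : c ≠ 0)
    (θ x y z : ℕ → F)
    (hθ : ∀ i : ℕ, i ≤ d → θ i = α + a * q ^ (2 * (i : ℤ) - (d : ℤ)) + a' * q ^ ((d : ℤ) - 2 * (i : ℤ)))
    (hx : ∀ i : ℕ, i ≤ d → x i = αs + (b + b') * q ^ ((d : ℤ) - 2 * (i : ℤ)) + a' * c * q ^ ((d : ℤ) - 2 * (i : ℤ)) * (q ^ ((d : ℤ) + 1) + q ^ (-(d : ℤ) - 1) - q ^ ((d : ℤ) - 2 * (i : ℤ) - 1) - q ^ ((d : ℤ) - 2 * (i : ℤ) + 1)))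
    (hy : ∀ i : ℕ, 1 ≤ i → i ≤ d → y i = (q ^ (i : ℤ) - q ^ (-(i : ℤ))) * (q ^ ((d : ℤ) - (i : ℤ) + 1) - q ^ ((i : ℤ) - (d : ℤ) - 1)) * (b - a' * c * q ^ ((d : ℤ) - 2 * (i : ℤ) + 1)) * (b' - a' * c * q ^ ((d : ℤ) - 2 * (i : ℤ) + 1)) * c⁻¹)
    (hz : ∀ i : ℕ, 1 ≤ i → i ≤ d → z i = -(c * q ^ ((d : ℤ) - 2 * (i : ℤ) + 1)))
    (A As : Matrix (Fin (d + 1)) (Fin (d + 1)) F)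
    (hA : ∀ i j : Fin (d + 1), A i j =
      if (i : ℕ) = (j : ℕ) then θ (i : ℕ)
      else if (i : ℕ) = (j : ℕ) + 1 then 1 else 0)
    (hAs : ∀ i j : Fin (d + 1), As i j =
      if (i : ℕ) = (j : ℕ) then x (i : ℕ)
      else if (i : ℕ) = (j : ℕ) + 1 then z (i : ℕ)
      else if (j : ℕ) = (i : ℕ) + 1 then y (j : ℕ) else 0) :
    (IsIrredTridiagonal As ∧ IsLeonardPair A As) ↔
    ((∀ j : ℕ, 1 ≤ j → j ≤ 2 * d - 1 → a ≠ a' * q ^ (2 * (d : ℤ) - 2 * (j : ℤ))) ∧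
     (∀ j : ℕ, 1 ≤ j → j ≤ 2 * d - 1 → b ≠ b' * q ^ (2 * (d : ℤ) - 2 * (j : ℤ))) ∧
     (∀ j : ℕ, 1 ≤ j → j ≤ d →
       b * c⁻¹ ≠ a * q ^ ((d : ℤ) - 2 * (j : ℤ) + 1) ∧
       b * c⁻¹ ≠ a' * q ^ ((d : ℤ) - 2 * (j : ℤ) + 1) ∧
       b' * c⁻¹ ≠ a * q ^ ((d : ℤ) - 2 * (j : ℤ) + 1) ∧
       b' * c⁻¹ ≠ a' * q ^ ((d : ℤ) - 2 * (j : ℤ) + 1))) := by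
  have hp : q ^ d ≠ 0 := pow_ne_zero _ hq
  have hA' : A = lbMatrix d q a a' + α • 1 := by
    ext i j
    rw [hA, Matrix.add_apply, Matrix.smul_apply, Matrix.one_apply]
    simp only [lbMatrix, bandMatrix, Matrix.of_apply, Fin.ext_iff]
    split_ifs
    · rw [hθ _ (by omega), lbEig, zpow_two_mul_sub hq, zpow_sub_two_mul hq]
      simp only [zpow_natCast, smul_eq_mul]
      ring
    · simp
    · simp
    · simp
  have hB' : As = tdMatrix d q a' b b' c + αs • 1 := by
    ext i j
    rw [hAs, Matrix.add_apply, Matrix.smul_apply, Matrix.one_apply]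
    simp only [tdMatrix, bandMatrix, Matrix.of_apply, Fin.ext_iff]
    have hr : q ^ (i : ℕ) ≠ 0 := pow_ne_zero _ hq
    split_ifs
    · rw [hx _ (by omega), tdDiag, zpow_sub_one₀ hq, zpow_sub_one₀ hq, zpow_add_one₀ hq,
        zpow_add_one₀ hq, zpow_sub_two_mul hq, zpow_neg]
      simp only [zpow_natCast, smul_eq_mul]
      field_simp
      ring
    · rw [hz _ (by omega) (by omega), tdSub, zpow_add_one₀ hq, zpow_sub_two_mul hq]
      simp only [zpow_natCast, smul_zero, add_zero]
      ring
    · have hr' : q ^ (j : ℕ) ≠ 0 := pow_ne_zero _ hq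
      rw [hy _ (by omega) (by omega), tdSup, zpow_add_one₀ hq, zpow_add_one₀ hq,
        zpow_sub_one₀ hq, zpow_sub₀ hq, zpow_sub₀ hq, zpow_sub_two_mul hq, zpow_neg]
      simp only [zpow_natCast, smul_zero, add_zero]
      field_simp
    · simp
  rw [hA', hB', isIrredTridiagonal_add_smul_one_iff, isLeonardPair_add_smul_one_iff,
    isLeonardPair_lbMatrix_tdMatrix_iff (by omega) hq hqru hc, isSeparated_iff, isSeparated_iff]
  refine and_congr_right fun _ => and_congr_right fun _ => ?_
  have hdiv : ∀ u s e : F, u - s * c * e ≠ 0 ↔ u * c⁻¹ ≠ s * e := by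
    intro u s e
    rw [Ne, Ne, sub_eq_zero, ← div_eq_mul_inv, div_eq_iff hc, mul_right_comm]
  simp only [mul_ne_zero_iff, hdiv]
  constructor
  · rintro ⟨h1, h2⟩ j hj1 hjd
    have h3 := h2 (d - j) (by omega)
    rw [pow_sub_sq_mul_div hq hjd] at h3
    rw [zpow_add_one₀ hq, zpow_sub_two_mul hq, div_mul_eq_mul_div, zpow_natCast,
      zpow_natCast]
    exact ⟨h3.1, (h1 j hj1 hjd).1, h3.2, (h1 j hj1 hjd).2⟩
  · intro h
    have h' : ∀ j : ℕ, 1 ≤ j → j ≤ d → _ := fun j hj1 hjd => by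
      have := h j hj1 hjd
      rwa [zpow_add_one₀ hq, zpow_sub_two_mul hq, div_mul_eq_mul_div, zpow_natCast,
        zpow_natCast] at this
    refine ⟨fun j hj1 hjd => ⟨(h' j hj1 hjd).2.1, (h' j hj1 hjd).2.2.2⟩, fun j hj => ?_⟩
    have h1 := h' (d - j) (by omega) (by omega)
    rw [← pow_sub_sq_mul_div hq (by omega), Nat.sub_sub_self hj.le] at h1
    exact ⟨h1.1, h1.2.2.1⟩
end

section
/- Fix a nonzero scalar q ∈ F that is not a root of unity, and scalars α, α*, a, a′, b, b′, c ∈ F with c ≠ 0. Define θ_i = α + a·q^{2i−d} + a′·q^{d−2i}, θ*_i = α* + b·q^{2i−d} + b′·q^{d−2i}, and x_i = α* + (b+b′)q^{d−2i} + a′c·q^{d−2i}(q^{d+1} + q^{−d−1} − q^{d−2i−1} − q^{d−2i+1}) for 0 ≤ i ≤ d; define y_i = (q^i − q^{−i})(q^{d−i+1} − q^{i−d−1})(b − a′c·q^{d−2i+1})(b′ − a′c·q^{d−2i+1})c^{−1}, z_i = −c·q^{d−2i+1}, and φ_i = (q^i − q^{−i})(q^{d−i+1} − q^{i−d−1})(b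 − a′c·q^{d−2i+1})(b′ − ac·q^{2i−d−1})c^{−1} for 1 ≤ i ≤ d. Let A ∈ Mat_{d+1}(F) be the lower bidiagonal matrix with diagonal entries θ_0,…,θ_d and all subdiagonal entries 1, and A* ∈ Mat_{d+1}(F) the tridiagonal matrix with diagonal entries x_0,…,x_d, superdiagonal entries y_1,…,y_d, and subdiagonal entries z_1,…,z_d. For 0 ≤ r ≤ d let u_r ∈ F^{d+1} be the column vector whose i-th entry is (u_r)_i = (−1)^{r+i} c^{i−r} q^{(d+r−i)(d−r+i−1)/2} · ∏_{h=0}^{d+r−i−1}(q^{d−h} − q^{h−d}) · ∏_{h=0}^{r−1}(b′ − ac·q^{2h−d+1}) · ∏_{h=0}^{d−i−1}(b′ − a′c·q^{2h−d+1}) for 0 ≤ i ≤ d. Then A·u_r = θ_r·u_r + u_{r+1} for 0 ≤ r ≤ d−1, A·u_d = θ_d·u_d, A*·u_r = θ*_r·u_r + φ_r·u_{r−1} for 1 ≤ r ≤ d, and A*·u_0 = θ*_0·u_0. -/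
theorem sum_fin_tridiagonal {F : Type*} [Field F] (d i : ℕ) (hi : i ≤ d) (x z y v : ℕ → F) :
    ∑ j : Fin (d + 1), (if i = (j : ℕ) then x i else if i = (j : ℕ) + 1 then z i
      else if (j : ℕ) = i + 1 then y j else 0) * v j =
    x i * v i + (if i = 0 then 0 else z i * v (i - 1)) +
      (if i = d then 0 else y (i + 1) * v (i + 1)) := by
  rw [Fin.sum_univ_eq_sum_range (fun j => (if i = j then x i else if i = j + 1 then z i
      else if j = i + 1 then y j else 0) * v j) (d + 1)]
  have key : ∀ j ∈ Finset.range (d + 1), (if i = j then x i else if i = j + 1 then z i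
      else if j = i + 1 then y j else 0) * v j =
      (if i = j then x j * v j else 0) +
      (if i - 1 = j then (if i = 0 then 0 else z i * v j) else 0) +
      (if i + 1 = j then y j * v j else 0) := by
    intro j _
    split_ifs <;> first | omega | (subst_vars; simp)
  rw [Finset.sum_congr rfl key]
  simp only [Finset.sum_add_distrib, Finset.sum_ite_eq, Finset.mem_range]
  rw [if_pos (by omega), if_pos (by omega)]
  congr 1
  split_ifs <;> first | omega | rfl

/-- The factor of the `i`-th entry of `u_r` that depends only on `m = d + r - i`. -/
def diagonalFactor {F : Type*} [Field F] (q c : F) (d m : ℕ) : F :=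
  (-1) ^ d * c ^ d * (-c⁻¹) ^ m * q ^ (((m : ℤ) * (2 * (d : ℤ) - 1 - m)) / 2) *
    ∏ h ∈ Finset.range m, (q ^ ((d : ℤ) - (h : ℤ)) - q ^ ((h : ℤ) - (d : ℤ)))

/-- The products `∏ (b' - t q^(2h - d + 1))` over `h < n`. -/
def qProduct {F : Type*} [Field F] (q b' t : F) (d n : ℕ) : F :=
  ∏ h ∈ Finset.range n, (b' - t * q ^ (2 * (h : ℤ) - (d : ℤ) + 1))

section
variable {F : Type*} [Field F] {q : F}

theorem diagonalFactor_succ (hq : q ≠ 0) (c : F) (d m : ℕ) :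
    diagonalFactor q c d (m + 1) =
      -c⁻¹ * q⁻¹ * ((q ^ d) ^ 2 / (q ^ m) ^ 2 - 1) * diagonalFactor q c d m := by
  have hE : (((m + 1 : ℕ) : ℤ) * (2 * (d : ℤ) - 1 - (m + 1 : ℕ))) / 2 =
      ((m : ℤ) * (2 * (d : ℤ) - 1 - m)) / 2 + ((d : ℤ) - 1 - m) := by
    rw [← Int.add_mul_ediv_right _ _ (by norm_num)]
    congr 1
    push_cast
    ring
  have hm : q ^ m ≠ 0 := pow_ne_zero _ hq
  have hd : q ^ d ≠ 0 := pow_ne_zero _ hq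
  unfold diagonalFactor
  rw [hE, Finset.prod_range_succ, zpow_add₀ hq, pow_succ (-c⁻¹)]
  simp only [zpow_sub₀ hq, zpow_natCast, zpow_one]
  generalize (∏ h ∈ Finset.range m, (q ^ d / q ^ h - q ^ h / q ^ d)) = P
  generalize q ^ (((m : ℤ) * (2 * (d : ℤ) - 1 - m)) / 2) = E
  generalize (-c⁻¹) ^ m = S
  generalize c⁻¹ = e
  generalize q ^ m = M at *
  generalize q ^ d = D at *
  field_simp

theorem diagonalFactor_eq_zero (c : F) {d m : ℕ} (h : d < m) : diagonalFactor q c d m = 0 := by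
  unfold diagonalFactor
  rw [Finset.prod_eq_zero (Finset.mem_range.2 h) (by simp), mul_zero]

theorem qProduct_succ (hq : q ≠ 0) (b' t : F) (d n : ℕ) :
    qProduct q b' t d (n + 1) = qProduct q b' t d n * (b' - t * ((q ^ n) ^ 2 * q / q ^ d)) := by
  unfold qProduct
  rw [Finset.prod_range_succ, zpow_add₀ hq, zpow_sub₀ hq, two_mul, zpow_add₀ hq]
  simp only [zpow_natCast, zpow_one]
  ring

theorem splitVector_eq {c : F} (hc : c ≠ 0) (b' s t : F) {d i : ℕ} (r : ℕ) (hi : i ≤ d) :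
    (-1 : F) ^ (r + i) * c ^ ((i : ℤ) - (r : ℤ)) *
      q ^ ((((d : ℤ) + (r : ℤ) - (i : ℤ)) * ((d : ℤ) - (r : ℤ) + (i : ℤ) - 1)) / 2) *
      (∏ h ∈ Finset.range (d + r - i), (q ^ ((d : ℤ) - (h : ℤ)) - q ^ ((h : ℤ) - (d : ℤ)))) *
      (∏ h ∈ Finset.range r, (b' - s * q ^ (2 * (h : ℤ) - (d : ℤ) + 1))) *
      (∏ h ∈ Finset.range (d - i), (b' - t * q ^ (2 * (h : ℤ) - (d : ℤ) + 1))) =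
    diagonalFactor q c d (r + (d - i)) * qProduct q b' s d r * qProduct q b' t d (d - i) := by
  obtain ⟨k, rfl⟩ := Nat.exists_eq_add_of_le hi
  have h1 : i + k + r - i = r + k := by omega
  have h2 : i + k - i = k := by omega
  rw [h1, h2]
  unfold diagonalFactor qProduct
  have h3 : (((i + k : ℕ) : ℤ) + r - i) * (((i + k : ℕ) : ℤ) - r + i - 1) =
      ((r + k : ℕ) : ℤ) * (2 * ((i + k : ℕ) : ℤ) - 1 - (r + k : ℕ)) := by
    push_cast
    ring
  have h4 : (-1 : F) ^ (r + i) * c ^ ((i : ℤ) - (r : ℤ)) =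
      (-1) ^ (i + k) * c ^ (i + k) * (-c⁻¹) ^ (r + k) := by
    have h5 : (-1 : F) ^ k * (-1) ^ k = 1 := by rw [← mul_pow]; simp
    rw [zpow_sub₀ hc, zpow_natCast, zpow_natCast, neg_pow c⁻¹]
    simp only [pow_add, inv_pow]
    field_simp
    linear_combination -h5
  rw [h3, h4]

end

section
variable {F : Type*} [Field F] {q c D : F} {H B C : ℕ → F} {a a' b b' : F}

theorem lower_recurrence (hq : q ≠ 0) (hc : c ≠ 0) (hD : D ≠ 0)
    (hH : ∀ m, H (m + 1) = -c⁻¹ * q⁻¹ * (D ^ 2 / (q ^ m) ^ 2 - 1) * H m)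
    (hB : ∀ n, B (n + 1) = B n * (b' - a * c * ((q ^ n) ^ 2 * q / D)))
    (hC : ∀ n, C (n + 1) = C n * (b' - a' * c * ((q ^ n) ^ 2 * q / D))) (α : F) (r k : ℕ) :
    (α + a * (D / (q ^ k) ^ 2) + a' * ((q ^ k) ^ 2 / D)) * (H (r + k) * B r * C k) +
      H (r + (k + 1)) * B r * C (k + 1) =
    (α + a * ((q ^ r) ^ 2 / D) + a' * (D / (q ^ r) ^ 2)) * (H (r + k) * B r * C k) +
      H (r + 1 + k) * B (r + 1) * C k := by
  rw [← add_assoc, add_right_comm r 1 k, hH, hB, hC, pow_add]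
  have hr : q ^ r ≠ 0 := pow_ne_zero _ hq
  have hk : q ^ k ≠ 0 := pow_ne_zero _ hq
  generalize q ^ r = R at *
  generalize q ^ k = K at *
  field_simp
  ring

theorem tridiagonal_recurrence (hq : q ≠ 0) (hc : c ≠ 0) (hD : D ≠ 0)
    (hH : ∀ m, H (m + 1) = -c⁻¹ * q⁻¹ * (D ^ 2 / (q ^ m) ^ 2 - 1) * H m)
    (hB : ∀ n, B (n + 1) = B n * (b' - a * c * ((q ^ n) ^ 2 * q / D)))
    (hC : ∀ n, C (n + 1) = C n * (b' - a' * c * ((q ^ n) ^ 2 * q / D))) (αs : F) (r k : ℕ) :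
    (αs + (b + b') * ((q ^ k) ^ 2 / D) + a' * c * ((q ^ k) ^ 2 / D) *
        (D * q + 1 / (D * q) - (q ^ k) ^ 2 / (D * q) - (q ^ k) ^ 2 * q / D)) *
        (H (r + k) * B r * C k) +
      -(c * ((q ^ k) ^ 2 * q / D)) * (H (r + (k + 1)) * B r * C (k + 1)) +
      (if k = 0 then 0 else
        (D * q / q ^ k - q ^ k / (D * q)) * (q ^ k - 1 / q ^ k) *
        (b - a' * c * ((q ^ k) ^ 2 / (D * q))) * (b' - a' * c * ((q ^ k) ^ 2 / (D * q))) * c⁻¹ *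
        (H (r + (k - 1)) * B r * C (k - 1))) =
    (αs + b * ((q ^ r) ^ 2 / D) + b' * (D / (q ^ r) ^ 2)) * (H (r + k) * B r * C k) +
      (if r = 0 then 0 else
        (q ^ r - 1 / q ^ r) * (D * q / q ^ r - q ^ r / (D * q)) *
        (b - a' * c * (D * q / (q ^ r) ^ 2)) * (b' - a * c * ((q ^ r) ^ 2 / (D * q))) * c⁻¹ *
        (H (r - 1 + k) * B (r - 1) * C k)) := by
  have hcomm : ∀ m n : ℕ, m + 1 + n = m + n + 1 := fun m n => add_right_comm m 1 n
  rcases r with _ | r <;> rcases k with _ | k <;>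
  simp only [Nat.add_sub_cancel, ← add_assoc, hcomm, zero_add, add_zero, hH, hB, hC,
    pow_add, pow_zero, pow_one, if_true, Nat.add_eq_zero_iff, one_ne_zero, and_false, if_false] <;>
  field_simp <;>
  ring

end

/-- The split-basis computation in the proof of Propositions 1.6 and 1.10:
the vectors `u_r` satisfy `A u_r = θ_r u_r + u_(r+1)`, `A u_d = θ_d u_d`,
`A* u_r = θ*_r u_r + φ_r u_(r-1)` and `A* u_0 = θ*_0 u_0`. -/
theorem stmt2 {F : Type*} [Field F] [IsAlgClosed F] {d : ℕ} (hd : 3 ≤ d)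
    (q α αs a a' b b' c : F) (hq : q ≠ 0)
    (hqru : ∀ n : ℕ, 1 ≤ n → q ^ n ≠ 1) (hc : c ≠ 0)
    (θ θs x y z φ : ℕ → F)
    (hθ : ∀ i : ℕ, i ≤ d → θ i = α + a * q ^ (2 * (i : ℤ) - (d : ℤ)) + a' * q ^ ((d : ℤ) - 2 * (i : ℤ)))
    (hθs : ∀ i : ℕ, i ≤ d → θs i = αs + b * q ^ (2 * (i : ℤ) - (d : ℤ)) + b' * q ^ ((d : ℤ) - 2 * (i : ℤ)))
    (hx : ∀ i : ℕ, i ≤ d → x i = αs + (b + b') * q ^ ((d : ℤ) - 2 * (i : ℤ)) + a' * c * q ^ ((d : ℤ) - 2 * (i : ℤ)) * (q ^ ((d : ℤ) + 1) + q ^ (-(d : ℤ) - 1) - q ^ ((d : ℤ) - 2 * (i : ℤ) - 1) - q ^ ((d : ℤ) - 2 * (i : ℤ) + 1)))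
    (hy : ∀ i : ℕ, 1 ≤ i → i ≤ d → y i = (q ^ (i : ℤ) - q ^ (-(i : ℤ))) * (q ^ ((d : ℤ) - (i : ℤ) + 1) - q ^ ((i : ℤ) - (d : ℤ) - 1)) * (b - a' * c * q ^ ((d : ℤ) - 2 * (i : ℤ) + 1)) * (b' - a' * c * q ^ ((d : ℤ) - 2 * (i : ℤ) + 1)) * c⁻¹)
    (hz : ∀ i : ℕ, 1 ≤ i → i ≤ d → z i = -(c * q ^ ((d : ℤ) - 2 * (i : ℤ) + 1)))
    (hφ : ∀ i : ℕ, 1 ≤ i → i ≤ d → φ i = (q ^ (i : ℤ) - q ^ (-(i : ℤ))) * (q ^ ((d : ℤ) - (i : ℤ) + 1) - q ^ ((i : ℤ) - (d : ℤ) - 1)) * (b - a' * c * q ^ ((d : ℤ) - 2 * (i : ℤ) + 1)) * (b' - a * c * q ^ (2 * (i : ℤ) - (d : ℤ) - 1)) * c⁻¹)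
    (A As : Matrix (Fin (d + 1)) (Fin (d + 1)) F)
    (hA : ∀ i j : Fin (d + 1), A i j =
      if (i : ℕ) = (j : ℕ) then θ (i : ℕ)
      else if (i : ℕ) = (j : ℕ) + 1 then 1 else 0)
    (hAs : ∀ i j : Fin (d + 1), As i j =
      if (i : ℕ) = (j : ℕ) then x (i : ℕ)
      else if (i : ℕ) = (j : ℕ) + 1 then z (i : ℕ)
      else if (j : ℕ) = (i : ℕ) + 1 then y (j : ℕ) else 0)
    (u : ℕ → Fin (d + 1) → F)
    (hu : ∀ r : ℕ, r ≤ d → ∀ i : Fin (d + 1), u r i =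
      (-1 : F) ^ (r + (i : ℕ)) * c ^ ((i : ℤ) - (r : ℤ)) *
      q ^ ((((d : ℤ) + (r : ℤ) - (i : ℤ)) * ((d : ℤ) - (r : ℤ) + (i : ℤ) - 1)) / 2) *
      (∏ h ∈ Finset.range (d + r - (i : ℕ)), (q ^ ((d : ℤ) - (h : ℤ)) - q ^ ((h : ℤ) - (d : ℤ)))) *
      (∏ h ∈ Finset.range r, (b' - a * c * q ^ (2 * (h : ℤ) - (d : ℤ) + 1))) *
      (∏ h ∈ Finset.range (d - (i : ℕ)), (b' - a' * c * q ^ (2 * (h : ℤ) - (d : ℤ) + 1)))) :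
    (∀ r : ℕ, r ≤ d - 1 → A.mulVec (u r) = θ r • u r + u (r + 1)) ∧
    A.mulVec (u d) = θ d • u d ∧
    (∀ r : ℕ, 1 ≤ r → r ≤ d → As.mulVec (u r) = θs r • u r + φ r • u (r - 1)) ∧
    As.mulVec (u 0) = θs 0 • u 0 := by
  have hD : q ^ d ≠ 0 := pow_ne_zero _ hq
  set H := diagonalFactor q c d
  set B := qProduct q b' (a * c) d
  set C := qProduct q b' (a' * c) d
  have hH : ∀ m, H (m + 1) = -c⁻¹ * q⁻¹ * ((q ^ d) ^ 2 / (q ^ m) ^ 2 - 1) * H m :=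
    diagonalFactor_succ hq c d
  have hH0 : ∀ m, d < m → H m = 0 := fun m h => diagonalFactor_eq_zero c h
  have hB : ∀ n, B (n + 1) = B n * (b' - a * c * ((q ^ n) ^ 2 * q / q ^ d)) :=
    qProduct_succ hq b' (a * c) d
  have hC : ∀ n, C (n + 1) = C n * (b' - a' * c * ((q ^ n) ^ 2 * q / q ^ d)) :=
    qProduct_succ hq b' (a' * c) d
  have hV : ∀ r ≤ d, ∀ i : Fin (d + 1), u r i = H (r + (d - i)) * B r * C (d - i) :=
    fun r hr i => (hu r hr i).trans (splitVector_eq hc b' (a * c) (a' * c) r (by omega))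
  have hAu : ∀ r ≤ d, ∀ i : Fin (d + 1), A.mulVec (u r) i =
      θ r * u r i + H (r + 1 + (d - i)) * B (r + 1) * C (d - i) := by
    intro r hr i
    obtain ⟨k, hk⟩ := Nat.exists_eq_add_of_le (Nat.le_of_lt_succ i.2)
    have hki : d - (i : ℕ) = k := by omega
    have hsum := sum_fin_tridiagonal d i (by omega) θ (fun _ => 1) (fun _ => 0)
      (fun j => H (r + (d - j)) * B r * C (d - j))
    have hlow : (if (i : ℕ) = 0 then 0 else 1 * (H (r + (d - (i - 1))) * B r * C (d - (i - 1)))) =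
        H (r + (k + 1)) * B r * C (k + 1) := by
      split_ifs with h
      · rw [hH0 _ (by omega)]; ring
      · rw [show d - ((i : ℕ) - 1) = k + 1 by omega, one_mul]
    simp only [ite_self, zero_mul, add_zero, hlow] at hsum
    simp only [Matrix.mulVec, dotProduct, hA, hV r hr]
    rw [hsum, hki, hθ _ hr, hθ _ (by omega)]
    have hi : (i : ℤ) = d - k := by omega
    have e1 : q ^ (2 * (i : ℤ) - d) = q ^ d / (q ^ k) ^ 2 := by
      rw [hi, show 2 * ((d : ℤ) - k) - d = d - (k + k) by ring, zpow_sub₀ hq, zpow_add₀ hq]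
      simp only [zpow_natCast, sq]
    have e2 : q ^ ((d : ℤ) - 2 * i) = (q ^ k) ^ 2 / q ^ d := by
      rw [hi, show (d : ℤ) - 2 * (d - k) = k + k - d by ring, zpow_sub₀ hq, zpow_add₀ hq]
      simp only [zpow_natCast, sq]
    have e3 : q ^ (2 * (r : ℤ) - d) = (q ^ r) ^ 2 / q ^ d := by
      rw [two_mul, zpow_sub₀ hq, zpow_add₀ hq]
      simp only [zpow_natCast, sq]
    have e4 : q ^ ((d : ℤ) - 2 * r) = q ^ d / (q ^ r) ^ 2 := by
      rw [two_mul, zpow_sub₀ hq, zpow_add₀ hq]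
      simp only [zpow_natCast, sq]
    rw [e1, e2, e3, e4]
    exact lower_recurrence hq hc hD hH hB hC α r k
  have hAsu : ∀ r ≤ d, ∀ i : Fin (d + 1), As.mulVec (u r) i =
      θs r * u r i + if r = 0 then 0 else φ r * u (r - 1) i := by
    intro r hr i
    obtain ⟨k, hk⟩ := Nat.exists_eq_add_of_le (Nat.le_of_lt_succ i.2)
    have hki : d - (i : ℕ) = k := by omega
    have hsum := sum_fin_tridiagonal d i (by omega) x z y
      (fun j => H (r + (d - j)) * B r * C (d - j))
    have hi : (i : ℤ) = d - k := by omega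
    have hlow : (if (i : ℕ) = 0 then 0 else
        z i * (H (r + (d - (i - 1))) * B r * C (d - (i - 1)))) =
        -(c * ((q ^ k) ^ 2 * q / q ^ d)) * (H (r + (k + 1)) * B r * C (k + 1)) := by
      split_ifs with h
      · rw [hH0 _ (by omega)]; ring
      · rw [show d - ((i : ℕ) - 1) = k + 1 by omega, hz _ (by omega) (by omega), hi,
          show (d : ℤ) - 2 * (d - k) + 1 = k + k + 1 - d by ring, zpow_sub₀ hq, zpow_add₀ hq,
          zpow_add₀ hq]
        simp only [zpow_natCast, zpow_one, sq]
    have hup : (if (i : ℕ) = d then 0 else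
        y (i + 1) * (H (r + (d - (i + 1))) * B r * C (d - (i + 1)))) =
        if k = 0 then 0 else
        (q ^ d * q / q ^ k - q ^ k / (q ^ d * q)) * (q ^ k - 1 / q ^ k) *
        (b - a' * c * ((q ^ k) ^ 2 / (q ^ d * q))) *
        (b' - a' * c * ((q ^ k) ^ 2 / (q ^ d * q))) * c⁻¹ *
        (H (r + (k - 1)) * B r * C (k - 1)) := by
      by_cases h : k = 0
      · rw [if_pos h, if_pos (by omega)]
      · rw [if_neg h, if_neg (by omega), show d - ((i : ℕ) + 1) = k - 1 by omega,
          hy _ (by omega) (by omega)]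
        push_cast
        rw [hi, show (d : ℤ) - (d - k + 1) + 1 = k by ring,
          show (d : ℤ) - k + 1 - d - 1 = -k by ring,
          show (d : ℤ) - 2 * (d - k + 1) + 1 = k + k - (d + 1) by ring,
          show -((d : ℤ) - k + 1) = k - (d + 1) by ring,
          show (d : ℤ) - k + 1 = d + 1 - k by ring]
        simp only [zpow_sub₀ hq, zpow_add₀ hq, zpow_neg, zpow_natCast, zpow_one, sq, one_div]
    have hlast : (if r = 0 then 0 else φ r * u (r - 1) i) = if r = 0 then 0 else
        (q ^ r - 1 / q ^ r) * (q ^ d * q / q ^ r - q ^ r / (q ^ d * q)) *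
        (b - a' * c * (q ^ d * q / (q ^ r) ^ 2)) *
        (b' - a * c * ((q ^ r) ^ 2 / (q ^ d * q))) * c⁻¹ *
        (H (r - 1 + k) * B (r - 1) * C k) := by
      by_cases h : r = 0
      · rw [if_pos h, if_pos h]
      · rw [if_neg h, if_neg h, hφ _ (by omega) hr, hV _ (by omega), hki,
          show (d : ℤ) - r + 1 = d + 1 - r by ring,
          show (r : ℤ) - d - 1 = r - (d + 1) by ring,
          show (d : ℤ) - 2 * r + 1 = d + 1 - (r + r) by ring,
          show 2 * (r : ℤ) - d - 1 = r + r - (d + 1) by ring]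
        simp only [zpow_sub₀ hq, zpow_add₀ hq, zpow_neg, zpow_natCast, zpow_one, sq, one_div]
    rw [hlast]
    simp only [Matrix.mulVec, dotProduct, hAs, hV r hr]
    rw [hsum, hlow, hup, hki, hθs _ hr, hx _ (by omega), hi,
      show (d : ℤ) - 2 * (d - k) - 1 = k + k - (d + 1) by ring,
      show (d : ℤ) - 2 * (d - k) + 1 = k + k + 1 - d by ring,
      show (d : ℤ) - 2 * (d - k) = k + k - d by ring,
      show -(d : ℤ) - 1 = -(d + 1) by ring, two_mul]
    have key := tridiagonal_recurrence (b := b) hq hc hD hH hB hC αs r k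
    simp only [zpow_sub₀ hq, zpow_add₀ hq, zpow_neg, zpow_natCast, zpow_one]
    simpa only [sq, one_div] using key
  refine ⟨fun r hr => ?_, ?_, fun r hr hrd => ?_, ?_⟩
  · ext i
    rw [hAu r (by omega) i, ← hV (r + 1) (by omega) i]
    simp
  · ext i
    rw [hAu d le_rfl i, hH0 _ (by omega)]
    simp
  · ext i
    rw [hAsu r hrd i, if_neg (by omega)]
    simp
  · ext i
    rw [hAsu 0 (Nat.zero_le d) i]
    simp
end
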